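/- Let d ≥ 2 and let Ω₁ ⊆ Ω₂ ⊂ ℝ^d be nonempty bounded convex open sets, and let D₂ = diam(Ω₂) denote the diameter of Ω₂. Then μ₁(Ω₁) ≥ π²/D₂² (the Payne–Weinberger bound for Ω₁ combined with monotonicity of the diameter under inclusion). -/

import Mathlib

open MeasureTheory Real Filter

noncomputable section

/-- Euclidean space `ℝ^d`. -/
abbrev Euc (d : ℕ) := EuclideanSpace ℝ (Fin d)

/-- The Rayleigh quotient of a function `u` on a set `Ω ⊆ ℝ^d`. -/
noncomputable def rayleigh {d : ℕ} (Ω : Set (Euc d)) (u : Euc d → ℝ) : ℝ :=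
  (∫ x in Ω, ‖fderiv ℝ u x‖ ^ 2) / (∫ x in Ω, (u x) ^ 2)

/-- The `k`-th Neumann eigenvalue of `Ω ⊆ ℝ^d`, defined by the variational (min-max)
principle: the infimum, over all subspaces `V` of smooth functions `ℝ^d → ℝ` whose space of
restrictions to `Ω` is `(k+1)`-dimensional, of the supremum of the Rayleigh quotient over
the elements of `V` that are nonzero in `L²(Ω)`. -/
noncomputable def neumannEigenvalue {d : ℕ} (k : ℕ) (Ω : Set (Euc d)) : ℝ :=
  sInf { t : ℝ | ∃ V : Submodule ℝ (Euc d → ℝ),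
    (∀ u ∈ V, ContDiff ℝ (⊤ : ℕ∞) u) ∧
    Module.finrank ℝ (V.map (LinearMap.funLeft ℝ ℝ ((↑) : Ω → Euc d))) = k + 1 ∧
    t = sSup { r : ℝ | ∃ u ∈ V, (0 < ∫ x in Ω, (u x) ^ 2) ∧ r = rayleigh Ω u } }

/-- A nonempty bounded convex open subset of `ℝ^d`. -/
def IsConvexDomain {d : ℕ} (Ω : Set (Euc d)) : Prop :=
  Ω.Nonempty ∧ IsOpen Ω ∧ Bornology.IsBounded Ω ∧ Convex ℝ Ω

/-- The optimal constant `α_{k,d}`: the infimum of `μ_k(Ω₁)/μ_k(Ω₂)` over all pairs of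
nonempty bounded convex open sets `Ω₁ ⊆ Ω₂ ⊂ ℝ^d`. -/
noncomputable def alphaConst (k d : ℕ) : ℝ :=
  sInf { r : ℝ | ∃ Ω₁ Ω₂ : Set (Euc d), IsConvexDomain Ω₁ ∧ IsConvexDomain Ω₂ ∧ Ω₁ ⊆ Ω₂ ∧
    r = neumannEigenvalue k Ω₁ / neumannEigenvalue k Ω₂ }

/-- The Bessel function of the first kind of order `ν` (for `x > 0`). -/
noncomputable def besselJ (ν : ℝ) (x : ℝ) : ℝ :=
  ∑' m : ℕ, ((-1 : ℝ) ^ m / (m.factorial * Real.Gamma (m + ν + 1))) * (x / 2) ^ (2 * (m : ℝ) + ν)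

/-- The first positive zero `j_{ν,1}` of the Bessel function `J_ν`. -/
noncomputable def besselZero1 (ν : ℝ) : ℝ :=
  sInf {x : ℝ | 0 < x ∧ besselJ ν x = 0}

/-- The second positive zero `j_{ν,2}` of the Bessel function `J_ν`. -/
noncomputable def besselZero2 (ν : ℝ) : ℝ :=
  sInf {x : ℝ | besselZero1 ν < x ∧ besselJ ν x = 0}


lemma pw_smooth1d (a b D : ℝ) (hab : a < b) (hD : b - a < D) (V V1 V2 v v1 : ℝ → ℝ)
    (hV : ∀ t, HasDerivAt V (V1 t) t) (hV1 : ∀ t, HasDerivAt V1 (V2 t) t)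
    (hV2c : Continuous V2) (hv : ∀ t, HasDerivAt v (v1 t) t) (hv1 : Continuous v1)
    (hpos : ∀ t ∈ Set.Icc a b, 0 ≤ V2 t) :
    ∃ c, (π / D) ^ 2 * ∫ t in a..b, (v t - c) ^ 2 * exp (-V t)
      ≤ ∫ t in a..b, v1 t ^ 2 * exp (-V t) := by
  have hVc : Continuous V := continuous_iff_continuousAt.2 fun t => (hV t).continuousAt
  have hV1c : Continuous V1 := continuous_iff_continuousAt.2 fun t => (hV1 t).continuousAt
  have hvc : Continuous v := continuous_iff_continuousAt.2 fun t => (hv t).continuousAt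
  have hD0 : 0 < D := by linarith
  set ρ := π / D with hρ
  have hρ0 : 0 < ρ := by positivity
  have hAI : 0 < ∫ t in a..b, exp (-V t) :=
    intervalIntegral.intervalIntegral_pos_of_pos (by
      exact (by fun_prop : Continuous fun t => exp (-V t)).intervalIntegrable _ _)
      (fun t => exp_pos _) hab
  set m := (∫ t in a..b, v t * exp (-V t)) / ∫ t in a..b, exp (-V t) with hm
  refine ⟨m, ?_⟩
  set F : ℝ → ℝ := fun t => ∫ s in a..t, (v s - m) * exp (-V s) with hF
  have hFd : ∀ t, HasDerivAt F ((v t - m) * exp (-V t)) t := fun t =>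
    intervalIntegral.integral_hasDerivAt_right
      ((by fun_prop : Continuous fun s => (v s - m) * exp (-V s)).intervalIntegrable _ _)
      (by fun_prop : Continuous fun s => (v s - m) * exp (-V s)).aestronglyMeasurable.stronglyMeasurableAtFilter
      (by fun_prop : Continuous fun s => (v s - m) * exp (-V s)).continuousAt
  have hFc : Continuous F := continuous_iff_continuousAt.2 fun t => (hFd t).continuousAt
  have hFa : F a = 0 := by simp [hF]
  have hFb : F b = 0 := by
    simp only [hF, sub_mul]
    rw [intervalIntegral.integral_sub
      ((by fun_prop : Continuous fun s => v s * exp (-V s)).intervalIntegrable _ _)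
      ((by fun_prop : Continuous fun s => m * exp (-V s)).intervalIntegrable _ _),
      intervalIntegral.integral_const_mul, hm]
    field_simp
    simp
  set s0 := a - (D - (b - a)) / 2 with hs0
  have hsin : ∀ t ∈ Set.Icc a b, 0 < sin (ρ * (t - s0)) := by
    intro t ht
    apply sin_pos_of_pos_of_lt_pi
    · apply mul_pos hρ0; linarith [ht.1]
    · have : t - s0 < D := by linarith [ht.2]
      calc ρ * (t - s0) < ρ * D := by gcongr
        _ = π := by rw [hρ]; field_simp
  set ct : ℝ → ℝ := fun t => cos (ρ * (t - s0)) / sin (ρ * (t - s0)) with hct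
  have hctd : ∀ t ∈ Set.Icc a b, HasDerivAt ct (-ρ * (1 + ct t ^ 2)) t := by
    intro t ht
    have h0 := (hsin t ht).ne'
    have h1 : HasDerivAt (fun t => ρ * (t - s0)) ρ t := by
      simpa using ((hasDerivAt_id t).sub_const s0).const_mul ρ
    have := h1.cos.div h1.sin h0
    refine this.congr_deriv ?_
    simp only [hct]
    field_simp
    ring
  have hctc : ContinuousOn ct (Set.Icc a b) := fun t ht => (hctd t ht).continuousAt.continuousWithinAt
  set q : ℝ → ℝ := fun t => -V1 t / 2 + ρ * ct t with hq
  have hqd : ∀ t ∈ Set.Icc a b, HasDerivAt q (-V2 t / 2 + ρ * (-ρ * (1 + ct t ^ 2))) t := by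
    intro t ht
    exact ((hV1 t).neg.div_const 2).add ((hctd t ht).const_mul ρ)
  set Φ : ℝ → ℝ := fun t => 2 * ρ ^ 2 * ((v t - m) * F t) - ρ ^ 2 * (F t ^ 2 * exp (V t) * q t) with hΦ
  set Φ' : ℝ → ℝ := fun t => 2 * ρ ^ 2 * (v1 t * F t + (v t - m) * ((v t - m) * exp (-V t)))
      - ρ ^ 2 * ((2 * F t * ((v t - m) * exp (-V t)) * exp (V t) + F t ^ 2 * (exp (V t) * V1 t)) * q t
        + F t ^ 2 * exp (V t) * (-V2 t / 2 + ρ * (-ρ * (1 + ct t ^ 2)))) with hΦ'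
  have hΦd : ∀ t ∈ Set.Icc a b, HasDerivAt Φ (Φ' t) t := by
    intro t ht
    have h1 := (((hv t).sub_const m).mul (hFd t)).const_mul (2 * ρ ^ 2)
    have h2 := ((((hFd t).pow 2).mul (hV t).exp).mul (hqd t ht)).const_mul (ρ ^ 2)
    refine (h1.sub h2).congr_deriv ?_
    simp only [hΦ', Pi.pow_apply, Pi.mul_apply]
    push_cast
    ring
  have hΦ'c : ContinuousOn Φ' (Set.Icc a b) := by
    simp only [hΦ', hq]
    fun_prop
  have hint : ∀ f : ℝ → ℝ, ContinuousOn f (Set.Icc a b) → IntervalIntegrable f volume a b := by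
    intro f hf
    apply ContinuousOn.intervalIntegrable
    rwa [Set.uIcc_of_le hab.le]
  have hI : ∫ t in a..b, Φ' t = 0 := by
    rw [intervalIntegral.integral_eq_sub_of_hasDerivAt (f := Φ) _ (hint _ hΦ'c)]
    · simp [hΦ, hFa, hFb]
    · rw [Set.uIcc_of_le hab.le]; exact hΦd
  have key : ∀ t ∈ Set.Icc a b,
      ρ ^ 2 * ((v t - m) ^ 2 * exp (-V t)) ≤ v1 t ^ 2 * exp (-V t) + Φ' t := by
    intro t ht
    have hE : exp (V t) * exp (-V t) = 1 := by rw [← exp_add]; simp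
    have hE' := exp_pos (V t)
    have hA' := exp_pos (-V t)
    have hp := hpos t ht
    simp only [hΦ', hq]
    generalize exp (V t) = E at *
    generalize exp (-V t) = A at *
    generalize F t = f
    generalize v t - m = w
    generalize ct t = c
    have n1 : 0 ≤ A * (v1 t + ρ ^ 2 * f * E) ^ 2 := by positivity
    have n2 : 0 ≤ ρ ^ 2 * (A * (w - f * E * (-V1 t / 2 + ρ * c)) ^ 2) := by positivity
    have n3 : 0 ≤ ρ ^ 2 * (f ^ 2 * E * (V1 t ^ 2 / 4 + V2 t / 2)) := by positivity
    have e1 : A * (v1 t + ρ ^ 2 * f * E) ^ 2 = A * v1 t ^ 2 + 2 * ρ ^ 2 * f * v1 t * (E * A)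
      + ρ ^ 4 * f ^ 2 * E * (E * A) := by ring
    have e2 : A * (w - f * E * (-V1 t / 2 + ρ * c)) ^ 2 = A * w ^ 2
      - 2 * w * f * (E * A) * (-V1 t / 2 + ρ * c) + f ^ 2 * E * (E * A) * (-V1 t / 2 + ρ * c) ^ 2 := by ring
    have e3 : 2 * f * (w * A) * E = 2 * f * w * (E * A) := by ring
    rw [e1, hE] at n1
    rw [e2, hE] at n2
    rw [e3, hE]
    nlinarith
  have hmono : ∫ t in a..b, ρ ^ 2 * ((v t - m) ^ 2 * exp (-V t)) ≤
      ∫ t in a..b, (v1 t ^ 2 * exp (-V t) + Φ' t) := by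
    apply intervalIntegral.integral_mono_on hab.le _ _ key
    · exact hint _ (by fun_prop)
    · exact hint _ (by fun_prop)
  rw [intervalIntegral.integral_add (hint _ (by fun_prop)) (hint _ hΦ'c), hI,
    intervalIntegral.integral_const_mul, add_zero] at hmono
  exact hmono
noncomputable def pwAvg (ε : ℝ) (U : ℝ → ℝ) (t : ℝ) : ℝ := ε⁻¹ * ∫ s in t..(t + ε), U s

lemma pwAvg_deriv (ε : ℝ) (U : ℝ → ℝ) (hU : Continuous U) (t : ℝ) :
    HasDerivAt (pwAvg ε U) (ε⁻¹ * (U (t + ε) - U t)) t := by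
  have h : ∀ x, pwAvg ε U x = ε⁻¹ * ((∫ s in (0:ℝ)..(x + ε), U s) - ∫ s in (0:ℝ)..x, U s) := by
    intro x
    rw [pwAvg, intervalIntegral.integral_interval_sub_left (hU.intervalIntegrable _ _)
      (hU.intervalIntegrable _ _)]
  have h1 : ∀ x, HasDerivAt (fun x => ∫ s in (0:ℝ)..x, U s) (U x) x := fun x =>
    intervalIntegral.integral_hasDerivAt_right (hU.intervalIntegrable _ _)
      hU.aestronglyMeasurable.stronglyMeasurableAtFilter hU.continuousAt
  have h2 : HasDerivAt (fun x => ∫ s in (0:ℝ)..(x + ε), U s) (U (t + ε)) t := by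
    have := HasDerivAt.comp_add_const t ε (h1 (t + ε))
    simpa using this
  rw [show pwAvg ε U = fun x => ε⁻¹ * ((∫ s in (0:ℝ)..(x + ε), U s) - ∫ s in (0:ℝ)..x, U s) from
    funext h]
  exact (h2.sub (h1 t)).const_mul _

lemma pwAvg_close (ε : ℝ) (hε : 0 < ε) (U : ℝ → ℝ) (hU : Continuous U) (t c η : ℝ)
    (h : ∀ s ∈ Set.Icc t (t + ε), |U s - c| ≤ η) : |pwAvg ε U t - c| ≤ η := by
  have hle : t ≤ t + ε := by linarith
  have h1 : ∫ s in t..(t + ε), U s ≤ ∫ s in t..(t + ε), (c + η) :=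
    intervalIntegral.integral_mono_on hle (hU.intervalIntegrable _ _) (by simp)
      (fun s hs => by linarith [(abs_le.1 (h s hs)).2])
  have h2 : ∫ s in t..(t + ε), (c - η) ≤ ∫ s in t..(t + ε), U s :=
    intervalIntegral.integral_mono_on hle (by simp) (hU.intervalIntegrable _ _)
      (fun s hs => by linarith [(abs_le.1 (h s hs)).1])
  simp only [intervalIntegral.integral_const, smul_eq_mul, add_sub_cancel_left] at h1 h2
  have h3 : pwAvg ε U t ≤ c + η := by
    rw [pwAvg]
    calc _ ≤ ε⁻¹ * (ε * (c + η)) := by gcongr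
      _ = _ := by field_simp
  have h4 : c - η ≤ pwAvg ε U t := by
    rw [pwAvg]
    calc c - η = ε⁻¹ * (ε * (c - η)) := by field_simp
      _ ≤ _ := by gcongr
  rw [abs_le]; constructor <;> linarith

lemma pw_smoothing (a b a' b' η : ℝ) (ha : a < a') (hab : a' < b') (hb : b' < b) (hη : 0 < η)
    (V : ℝ → ℝ) (hV : ConvexOn ℝ (Set.Ioo a b) V) :
    ∃ W W1 W2 : ℝ → ℝ, (∀ t, HasDerivAt W (W1 t) t) ∧ (∀ t, HasDerivAt W1 (W2 t) t) ∧
      Continuous W2 ∧ (∀ t ∈ Set.Icc a' b', 0 ≤ W2 t) ∧ ∀ t ∈ Set.Icc a' b', |W t - V t| ≤ η := by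
  obtain ⟨c, hc1, hc2⟩ := exists_between hb
  have hVc : ContinuousOn V (Set.Icc a' c) :=
    (hV.continuousOn isOpen_Ioo).mono (Set.Icc_subset_Ioo ha hc2)
  have hac : a' ≤ c := by linarith
  set U : ℝ → ℝ := Set.IccExtend hac ((Set.Icc a' c).domRestrict V) with hUdef
  have hUc : Continuous U := (continuousOn_iff_continuous_domRestrict.1 hVc).Icc_extend'
  have hUV : ∀ t ∈ Set.Icc a' c, U t = V t := fun t ht => by
    rw [hUdef, Set.IccExtend_of_mem hac _ ht]; rfl
  have huc : UniformContinuousOn U (Set.Icc a' c) :=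
    isCompact_Icc.uniformContinuousOn_of_continuous hUc.continuousOn
  rw [Metric.uniformContinuousOn_iff] at huc
  obtain ⟨δ, hδ, hu⟩ := huc η hη
  obtain ⟨ε, hε0, hε⟩ : ∃ ε > 0, 2 * ε < δ ∧ 2 * ε ≤ c - b' := by
    refine ⟨min δ (c - b') / 3, by apply div_pos (lt_min hδ (by linarith)); norm_num, ?_, ?_⟩
    · have := min_le_left δ (c - b'); linarith
    · have := min_le_right δ (c - b'); linarith
  have h1 : ∀ t, HasDerivAt (pwAvg ε U) (ε⁻¹ * (U (t + ε) - U t)) t := pwAvg_deriv ε U hUc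
  have hW0c : Continuous (pwAvg ε U) := continuous_iff_continuousAt.2 fun t => (h1 t).continuousAt
  refine ⟨pwAvg ε (pwAvg ε U), fun t => ε⁻¹ * (pwAvg ε U (t + ε) - pwAvg ε U t),
    fun t => ε⁻¹ * (ε⁻¹ * (U (t + ε + ε) - U (t + ε)) - ε⁻¹ * (U (t + ε) - U t)),
    pwAvg_deriv ε _ hW0c, ?_, by fun_prop, ?_, ?_⟩
  · intro t
    exact (((h1 (t + ε)).comp_add_const t ε).sub (h1 t)).const_mul _
  · intro t ht
    have m0 : t ∈ Set.Icc a' c := ⟨ht.1, by linarith [ht.2]⟩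
    have m1 : t + ε ∈ Set.Icc a' c := ⟨by linarith [ht.1], by linarith [ht.2]⟩
    have m2 : t + ε + ε ∈ Set.Icc a' c := ⟨by linarith [ht.1], by linarith [ht.2]⟩
    have hs := Set.Icc_subset_Ioo ha hc2
    beta_reduce
    rw [hUV _ m0, hUV _ m1, hUV _ m2]
    have := hV.2 (hs m0) (hs m2) (by norm_num : (0:ℝ) ≤ 1 / 2)
      (by norm_num : (0:ℝ) ≤ 1 / 2) (by norm_num)
    simp only [smul_eq_mul] at this
    rw [show 1 / 2 * t + 1 / 2 * (t + ε + ε) = t + ε by ring] at this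
    have : 0 ≤ (V (t + ε + ε) - V (t + ε)) - (V (t + ε) - V t) := by linarith
    rw [← mul_sub]
    positivity
  · intro t ht
    have m0 : t ∈ Set.Icc a' c := ⟨ht.1, by linarith [ht.2]⟩
    rw [← hUV t m0]
    apply pwAvg_close ε hε0 _ hW0c
    intro s hs
    apply pwAvg_close ε hε0 _ hUc
    intro r hr
    have := hu r ⟨by linarith [hr.1, hs.1, ht.1], by linarith [hr.2, hs.2, ht.2]⟩ t m0 (by
      rw [Real.dist_eq, abs_lt]; constructor <;> linarith [hr.1, hr.2, hs.1, hs.2])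
    rw [Real.dist_eq] at this
    exact this.le

lemma pw_log_inner (a b a' b' D : ℝ) (ha : a < a') (hab : a' < b') (hb : b' < b) (hD : b - a < D)
    (A v v1 : ℝ → ℝ) (hApos : ∀ t ∈ Set.Ioo a b, 0 < A t)
    (hconc : ConcaveOn ℝ (Set.Ioo a b) (fun t => log (A t)))
    (hv : ∀ t, HasDerivAt v (v1 t) t) (hv1 : Continuous v1) :
    (π / D) ^ 2 * ((∫ t in Set.Icc a' b', v t ^ 2 * A t) * (∫ t in Set.Icc a' b', A t)
      - (∫ t in Set.Icc a' b', v t * A t) ^ 2)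
      ≤ (∫ t in Set.Icc a' b', v1 t ^ 2 * A t) * (∫ t in Set.Icc a' b', A t) := by
  have hsub : Set.Icc a' b' ⊆ Set.Ioo a b := Set.Icc_subset_Ioo ha hb
  have hvc : Continuous v := continuous_iff_continuousAt.2 fun t => (hv t).continuousAt
  have hlc : ContinuousOn (fun t => log (A t)) (Set.Icc a' b') :=
    (hconc.continuousOn isOpen_Ioo).mono hsub
  have hAc : ContinuousOn A (Set.Icc a' b') := by
    have : ContinuousOn (fun t => exp (log (A t))) (Set.Icc a' b') := hlc.rexp
    exact this.congr fun t ht => (exp_log (hApos t (hsub ht))).symm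
  have hint : ∀ f : ℝ → ℝ, ContinuousOn f (Set.Icc a' b') → IntegrableOn f (Set.Icc a' b') :=
    fun f hf => hf.integrableOn_compact isCompact_Icc
  have hA0 : ∀ t ∈ Set.Icc a' b', 0 ≤ A t := fun t ht => (hApos t (hsub ht)).le
  set S0 := ∫ t in Set.Icc a' b', A t with hS0
  set S1 := ∫ t in Set.Icc a' b', v t * A t with hS1
  set S2 := ∫ t in Set.Icc a' b', v t ^ 2 * A t with hS2
  set T := ∫ t in Set.Icc a' b', v1 t ^ 2 * A t with hT
  have hS0n : 0 ≤ S0 := setIntegral_nonneg measurableSet_Icc hA0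
  have hTn : 0 ≤ T := setIntegral_nonneg measurableSet_Icc fun t ht =>
    mul_nonneg (sq_nonneg _) (hA0 t ht)
  -- the estimate with a loss
  have hloss : ∀ η > 0, exp (-(2 * η)) * ((π / D) ^ 2 * (S2 * S0 - S1 ^ 2)) ≤ T * S0 := by
    intro η hη
    obtain ⟨W, W1, W2, hW, hW1, hW2c, hW2, hWV⟩ := pw_smoothing a b a' b' η ha hab hb hη
      (fun t => -log (A t)) hconc.neg
    obtain ⟨c, hc⟩ := pw_smooth1d a' b' D hab (by linarith) W W1 W2 v v1 hW hW1 hW2c hv hv1 hW2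
    have hWc : Continuous W := continuous_iff_continuousAt.2 fun t => (hW t).continuousAt
    rw [intervalIntegral.integral_of_le hab.le, intervalIntegral.integral_of_le hab.le,
      ← integral_Icc_eq_integral_Ioc, ← integral_Icc_eq_integral_Ioc] at hc
    have up : ∀ t ∈ Set.Icc a' b', exp (-W t) ≤ exp η * A t := by
      intro t ht
      rw [← exp_log (hApos t (hsub ht)), ← exp_add]
      have := (abs_le.1 (hWV t ht)).1
      apply exp_le_exp.2
      linarith
    have low : ∀ t ∈ Set.Icc a' b', exp (-η) * A t ≤ exp (-W t) := by
      intro t ht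
      rw [← exp_log (hApos t (hsub ht)), ← exp_add]
      have := (abs_le.1 (hWV t ht)).2
      apply exp_le_exp.2
      linarith
    have i1 : ∫ t in Set.Icc a' b', v1 t ^ 2 * exp (-W t) ≤ exp η * T := by
      rw [hT, ← integral_const_mul]
      apply setIntegral_mono_on (hint _ (by fun_prop)) (hint _ (by fun_prop)) measurableSet_Icc
      intro t ht
      have := up t ht
      calc _ ≤ v1 t ^ 2 * (exp η * A t) := by gcongr
        _ = _ := by ring
    have i2 : exp (-η) * (∫ t in Set.Icc a' b', (v t - c) ^ 2 * A t) ≤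
        ∫ t in Set.Icc a' b', (v t - c) ^ 2 * exp (-W t) := by
      rw [← integral_const_mul]
      apply setIntegral_mono_on (hint _ (by fun_prop)) (hint _ (by fun_prop)) measurableSet_Icc
      intro t ht
      have := low t ht
      calc _ = (v t - c) ^ 2 * (exp (-η) * A t) := by ring
        _ ≤ _ := by gcongr
    have i3 : ∫ t in Set.Icc a' b', (v t - c) ^ 2 * A t = S2 - 2 * c * S1 + c ^ 2 * S0 := by
      have : ∀ t, (v t - c) ^ 2 * A t = v t ^ 2 * A t - (2 * c) * (v t * A t) + c ^ 2 * A t := by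
        intro t; ring
      simp only [this]
      rw [integral_add, integral_sub, integral_const_mul, integral_const_mul]
      all_goals exact hint _ (by fun_prop)
    rw [i3] at i2
    have i4 : (S2 * S0 - S1 ^ 2) ≤ (S2 - 2 * c * S1 + c ^ 2 * S0) * S0 := by
      nlinarith [sq_nonneg (c * S0 - S1)]
    have i5 : (π / D) ^ 2 * (exp (-η) * (S2 - 2 * c * S1 + c ^ 2 * S0)) ≤ exp η * T :=
      (mul_le_mul_of_nonneg_left i2 (sq_nonneg _)).trans (hc.trans i1)
    have i6 : exp (-(2 * η)) * ((π / D) ^ 2 * (S2 - 2 * c * S1 + c ^ 2 * S0)) ≤ T := by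
      have e1 : exp (-(2 * η)) = exp (-η) * exp (-η) := by rw [← exp_add]; ring_nf
      have e2 : exp (-η) * exp η = 1 := by rw [← exp_add]; simp
      calc _ = exp (-η) * ((π / D) ^ 2 * (exp (-η) * (S2 - 2 * c * S1 + c ^ 2 * S0))) := by
            rw [e1]; ring
        _ ≤ exp (-η) * (exp η * T) := by gcongr
        _ = T := by rw [← mul_assoc, e2, one_mul]
    calc exp (-(2 * η)) * ((π / D) ^ 2 * (S2 * S0 - S1 ^ 2))
        ≤ exp (-(2 * η)) * ((π / D) ^ 2 * ((S2 - 2 * c * S1 + c ^ 2 * S0) * S0)) := by gcongr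
      _ = (exp (-(2 * η)) * ((π / D) ^ 2 * (S2 - 2 * c * S1 + c ^ 2 * S0))) * S0 := by ring
      _ ≤ T * S0 := by gcongr
  have hlim : Tendsto (fun η : ℝ => exp (-(2 * η)) * ((π / D) ^ 2 * (S2 * S0 - S1 ^ 2)))
      (nhdsWithin 0 (Set.Ioi 0)) (nhds ((π / D) ^ 2 * (S2 * S0 - S1 ^ 2))) := by
    have : Continuous (fun η : ℝ => exp (-(2 * η)) * ((π / D) ^ 2 * (S2 * S0 - S1 ^ 2))) := by
      fun_prop
    have := this.tendsto 0
    simp only [mul_zero, neg_zero, exp_zero, one_mul] at this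
    exact this.mono_left nhdsWithin_le_nhds
  exact le_of_tendsto hlim (eventually_nhdsWithin_of_forall hloss)

lemma pw_log (a b D : ℝ) (hab : a < b) (hD : b - a < D)
    (A v v1 : ℝ → ℝ) (hApos : ∀ t ∈ Set.Ioo a b, 0 < A t)
    (hconc : ConcaveOn ℝ (Set.Ioo a b) (fun t => log (A t)))
    (hAint : IntegrableOn A (Set.Ioo a b))
    (hv : ∀ t, HasDerivAt v (v1 t) t) (hv1 : Continuous v1) :
    (π / D) ^ 2 * ((∫ t in Set.Ioo a b, v t ^ 2 * A t) * (∫ t in Set.Ioo a b, A t)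
      - (∫ t in Set.Ioo a b, v t * A t) ^ 2)
      ≤ (∫ t in Set.Ioo a b, v1 t ^ 2 * A t) * (∫ t in Set.Ioo a b, A t) := by
  have hvc : Continuous v := continuous_iff_continuousAt.2 fun t => (hv t).continuousAt
  have hA : ∀ f : ℝ → ℝ, Continuous f → IntegrableOn (fun t => f t * A t) (Set.Ioo a b) := by
    intro f hf
    obtain ⟨C, hC⟩ := (isCompact_Icc (a := a) (b := b)).exists_bound_of_continuousOn hf.continuousOn
    refine Integrable.bdd_mul (c := C) hAint hf.aestronglyMeasurable ?_
    filter_upwards [ae_restrict_mem measurableSet_Ioo] with t ht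
    exact hC t (Set.Ioo_subset_Icc_self ht)
  set p : ℕ → ℝ := fun n => a + (b - a) / 3 * (1 / ((n : ℝ) + 1)) with hp
  set r : ℕ → ℝ := fun n => b - (b - a) / 3 * (1 / ((n : ℝ) + 1)) with hr
  have hpl : Tendsto p atTop (nhds a) := by
    have := (tendsto_one_div_add_atTop_nhds_zero_nat (𝕜 := ℝ)).const_mul ((b - a) / 3)
    simpa [hp] using this.const_add a
  have hrl : Tendsto r atTop (nhds b) := by
    have := (tendsto_one_div_add_atTop_nhds_zero_nat (𝕜 := ℝ)).const_mul ((b - a) / 3)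
    simpa [hr] using this.const_sub b
  have hx : ∀ n : ℕ, 0 < (b - a) / 3 * (1 / ((n : ℝ) + 1)) ∧
      (b - a) / 3 * (1 / ((n : ℝ) + 1)) ≤ (b - a) / 3 := by
    intro n
    have h0 : 0 < (b - a) / 3 := by linarith
    refine ⟨by positivity, ?_⟩
    have : 1 / ((n : ℝ) + 1) ≤ 1 := by
      rw [div_le_one (by positivity)]
      have : (0:ℝ) ≤ n := by positivity
      linarith
    nlinarith
  have lim : ∀ f : ℝ → ℝ, IntegrableOn f (Set.Ioo a b) →
      Tendsto (fun n => ∫ t in Set.Icc (p n) (r n), f t) atTop (nhds (∫ t in Set.Ioo a b, f t)) := by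
    intro f hf
    have := (aecover_Ioo_of_Icc (μ := volume) hpl hrl).integral_tendsto_of_countably_generated hf
    refine this.congr fun n => ?_
    rw [Measure.restrict_restrict measurableSet_Icc, Set.inter_eq_left.2]
    apply Set.Icc_subset_Ioo
    · have := (hx n).1; simp only [hp]; linarith
    · have := (hx n).1; simp only [hr]; linarith
  have l0 := lim A hAint
  have l1 := lim _ (hA v hvc)
  have l2 := lim _ (hA (fun t => v t ^ 2) (by fun_prop))
  have l3 := lim _ (hA (fun t => v1 t ^ 2) (by fun_prop))
  refine le_of_tendsto_of_tendsto' (((l2.mul l0).sub (l1.pow 2)).const_mul _) (l3.mul l0) ?_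
  intro n
  have := hx n
  exact pw_log_inner a b (p n) (r n) D (by simp only [hp]; linarith) (by simp only [hp, hr]; linarith)
    (by simp only [hr]; linarith) hD A v v1 hApos hconc hv hv1
open scoped ENNReal

lemma pw_bm_compact (X Y Z : Set ℝ) (hX : IsCompact X) (hY : IsCompact Y) (hX0 : X.Nonempty)
    (hY0 : Y.Nonempty) (hZ : ∀ x ∈ X, ∀ y ∈ Y, x + y ∈ Z) :
    volume X + volume Y ≤ volume Z := by
  have hm := hX.sSup_mem hX0
  have hn := hY.sInf_mem hY0
  set m := sSup X
  set n := sInf Y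
  set S := (fun x => x + n) '' X with hS
  set T := (fun y => m + y) '' Y with hT
  have hSc : IsCompact S := hX.image (by fun_prop)
  have hTc : IsCompact T := hY.image (by fun_prop)
  have hSv : volume S = volume X := by
    rw [hS]; simp
  have hTv : volume T = volume Y := by
    rw [hT]; simp
  have hT' : volume (T \ {m + n}) = volume Y := by
    rw [← hTv]; exact measure_sdiff_null (by simp)
  have hdisj : Disjoint S (T \ {m + n}) := by
    rw [Set.disjoint_left]
    rintro _ ⟨x, hx, rfl⟩ ⟨⟨y, hy, hxy⟩, hne⟩
    have h1 : x ≤ m := le_csSup hX.bddAbove hx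
    have h2 : n ≤ y := csInf_le hY.bddBelow hy
    apply hne
    simp only at hxy
    simp only [Set.mem_singleton_iff]
    linarith
  rw [← hSv, ← hT', ← measure_union hdisj (hTc.measurableSet.diff (measurableSet_singleton _))]
  apply measure_mono
  rintro z (⟨x, hx, rfl⟩ | ⟨⟨y, hy, rfl⟩, -⟩)
  · exact hZ x hx n hn
  · exact hZ m hm y hy

lemma pw_bm (X Y Z : Set ℝ) (hX : MeasurableSet X) (hY : MeasurableSet Y) (hX0 : X.Nonempty)
    (hY0 : Y.Nonempty) (hZ : ∀ x ∈ X, ∀ y ∈ Y, x + y ∈ Z) :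
    volume X + volume Y ≤ volume Z := by
  obtain ⟨x0, hx0⟩ := hX0
  obtain ⟨y0, hy0⟩ := hY0
  have hXZ : volume X ≤ volume Z := by
    calc volume X = volume ((fun x => x + y0) '' X) := by simp
      _ ≤ _ := measure_mono (by rintro _ ⟨x, hx, rfl⟩; exact hZ x hx y0 hy0)
  have hYZ : volume Y ≤ volume Z := by
    calc volume Y = volume ((fun y => x0 + y) '' Y) := by simp
      _ ≤ _ := measure_mono (by rintro _ ⟨y, hy, rfl⟩; exact hZ x0 hx0 y hy)
  by_cases hx : volume X = 0
  · simpa [hx] using hYZ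
  by_cases hy : volume Y = 0
  · simpa [hy] using hXZ
  by_contra! hcon
  obtain ⟨p, hp, r, hr, hpr⟩ := ENNReal.exists_lt_add_of_lt_add hcon hx hy
  obtain ⟨K, hKX, hK, hpK⟩ := hX.exists_lt_isCompact hp
  obtain ⟨K', hKY, hK', hrK⟩ := hY.exists_lt_isCompact hr
  have := pw_bm_compact K K' Z hK hK' (nonempty_of_measure_ne_zero (μ := volume) (pos_of_gt hpK).ne')
    (nonempty_of_measure_ne_zero (μ := volume) (pos_of_gt hrK).ne')
    (fun x hx y hy => hZ x (hKX hx) y (hKY hy))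
  exact absurd (hpr.trans_le ((add_le_add hpK.le hrK.le).trans this)) (lt_irrefl _)

lemma pw_bm_scaled (X Y Z : Set ℝ) (s : ℝ) (hs0 : 0 < s) (hs1 : s < 1)
    (hX : MeasurableSet X) (hY : MeasurableSet Y) (hX0 : X.Nonempty)
    (hY0 : Y.Nonempty) (hZ : ∀ x ∈ X, ∀ y ∈ Y, (1 - s) * x + s * y ∈ Z) :
    ENNReal.ofReal (1 - s) * volume X + ENNReal.ofReal s * volume Y ≤ volume Z := by
  have h1 : (1 - s) ≠ 0 := by linarith
  have e1 : volume ((fun x => (1 - s)⁻¹ * x) ⁻¹' X) = ENNReal.ofReal (1 - s) * volume X := by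
    rw [Real.volume_preimage_mul_left (inv_ne_zero h1), inv_inv, abs_of_pos (by linarith)]
  have e2 : volume ((fun x => s⁻¹ * x) ⁻¹' Y) = ENNReal.ofReal s * volume Y := by
    rw [Real.volume_preimage_mul_left (inv_ne_zero hs0.ne'), inv_inv, abs_of_pos hs0]
  rw [← e1, ← e2]
  apply pw_bm
  · exact measurable_const_mul _ hX
  · exact measurable_const_mul _ hY
  · obtain ⟨x, hx⟩ := hX0
    exact ⟨(1 - s) * x, by simpa [← mul_assoc, inv_mul_cancel₀ h1] using hx⟩
  · obtain ⟨x, hx⟩ := hY0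
    exact ⟨s * x, by simpa [← mul_assoc, inv_mul_cancel₀ hs0.ne'] using hx⟩
  · intro x hx y hy
    have := hZ _ hx _ hy
    rwa [← mul_assoc, ← mul_assoc, mul_inv_cancel₀ h1, mul_inv_cancel₀ hs0.ne', one_mul,
      one_mul] at this

/-- layer cake for functions bounded by one -/
lemma pw_layer (f : ℝ → ℝ≥0∞) (hf : Measurable f) (hf1 : ∀ x, f x ≤ 1) :
    ∫⁻ x, f x = ∫⁻ t in Set.Ioo (0:ℝ) 1, volume {x | ENNReal.ofReal t < f x} := by
  have hfin : ∀ x, f x ≠ ∞ := fun x => ((hf1 x).trans_lt ENNReal.one_lt_top).ne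
  have h := lintegral_eq_lintegral_meas_lt (f := fun x => (f x).toReal) volume
    (ae_of_all _ fun x => ENNReal.toReal_nonneg) hf.ennreal_toReal.aemeasurable
  simp only [ENNReal.ofReal_toReal (hfin _)] at h
  rw [h, ← Set.Ioo_union_Ici_eq_Ioi (zero_lt_one (α := ℝ)),
    lintegral_union measurableSet_Ici (by
      rw [Set.disjoint_left]; intro x hx hx'; exact absurd hx.2 (not_lt.2 hx'))]
  have z : ∫⁻ t in Set.Ici (1:ℝ), volume {a | t < (f a).toReal} = 0 := by
    rw [setLIntegral_congr_fun (g := fun _ => 0) measurableSet_Ici]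
    · simp
    · intro t ht
      have : {a | t < (f a).toReal} = ∅ := by
        ext a
        simp only [Set.mem_ofPred_eq, Set.mem_empty_iff_false, iff_false, not_lt]
        refine le_trans ?_ ht
        exact ENNReal.toReal_le_of_le_ofReal zero_le_one (by simpa using hf1 a)
      simp only [this, measure_empty]
  rw [z, add_zero]
  apply setLIntegral_congr_fun measurableSet_Ioo
  intro t ht
  simp only
  congr 1
  ext a
  simp only [Set.mem_ofPred_eq]
  exact (ENNReal.ofReal_lt_iff_lt_toReal ht.1.le (hfin a)).symm


open scoped ENNReal

lemma pw_pl_a (f g h : ℝ → ℝ≥0∞) (hf : Measurable f) (hg : Measurable g) (hh : Measurable h)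
    (s : ℝ) (hs0 : 0 < s) (hs1 : s < 1) (hf1 : ⨆ x, f x = 1) (hg1 : ⨆ x, g x = 1)
    (H : ∀ x y, f x ^ (1 - s) * g y ^ s ≤ h ((1 - s) * x + s * y)) :
    ENNReal.ofReal (1 - s) * (∫⁻ x, f x) + ENNReal.ofReal s * (∫⁻ x, g x) ≤ ∫⁻ x, h x := by
  have hfl : ∀ x, f x ≤ 1 := fun x => hf1 ▸ le_iSup f x
  have hgl : ∀ x, g x ≤ 1 := fun x => hg1 ▸ le_iSup g x
  refine le_trans ?_ (lintegral_mono (fun x => min_le_left (h x) 1))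
  rw [pw_layer f hf hfl, pw_layer g hg hgl,
    pw_layer (fun x => min (h x) 1) (hh.min measurable_const) (fun x => min_le_right _ _),
    ← lintegral_const_mul' _ _ ENNReal.ofReal_ne_top, ← lintegral_const_mul' _ _ ENNReal.ofReal_ne_top]
  refine (le_lintegral_add _ _).trans ?_
  apply setLIntegral_mono' measurableSet_Ioo
  intro t ht
  have ht1 : ENNReal.ofReal t < 1 := by
    rw [ENNReal.ofReal_lt_one]; exact ht.2
  apply pw_bm_scaled _ _ _ s hs0 hs1 (measurableSet_lt measurable_const hf)
    (measurableSet_lt measurable_const hg)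
  · rw [← hf1] at ht1; obtain ⟨x, hx⟩ := lt_iSup_iff.1 ht1; exact ⟨x, hx⟩
  · rw [← hg1] at ht1; obtain ⟨x, hx⟩ := lt_iSup_iff.1 ht1; exact ⟨x, hx⟩
  · intro x hx y hy
    refine lt_min ?_ ht1
    refine lt_of_lt_of_le ?_ (H x y)
    have hτ0 : ENNReal.ofReal t ≠ 0 := by simpa using ht.1
    calc ENNReal.ofReal t = ENNReal.ofReal t ^ (1 - s) * ENNReal.ofReal t ^ s := by
          rw [← ENNReal.rpow_add _ _ hτ0 ENNReal.ofReal_ne_top]; simp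
      _ < _ := ENNReal.mul_lt_mul (ENNReal.rpow_lt_rpow hx (by linarith))
          (ENNReal.rpow_lt_rpow hy hs0)

lemma pw_amgm (x y : ℝ≥0∞) (s : ℝ) (hs0 : 0 < s) (hs1 : s < 1) :
    x ^ (1 - s) * y ^ s ≤ ENNReal.ofReal (1 - s) * x + ENNReal.ofReal s * y := by
  have h1 : 0 < 1 - s := by linarith
  have hpq : ((1 - s)⁻¹).HolderConjugate (s⁻¹) := by
    rw [Real.holderConjugate_iff]
    refine ⟨?_, by simp⟩
    rw [one_lt_inv₀ h1]; linarith
  have := ENNReal.young_inequality (x ^ (1 - s)) (y ^ s) hpq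
  rw [← ENNReal.rpow_mul, ← ENNReal.rpow_mul, mul_inv_cancel₀ h1.ne', mul_inv_cancel₀ hs0.ne',
    ENNReal.rpow_one, ENNReal.rpow_one, ENNReal.ofReal_inv_of_pos h1, ENNReal.ofReal_inv_of_pos hs0,
    div_eq_mul_inv, div_eq_mul_inv, inv_inv, inv_inv, mul_comm x, mul_comm y] at this
  exact this

lemma pw_pl_b (f g h : ℝ → ℝ≥0∞) (hf : Measurable f) (hg : Measurable g) (hh : Measurable h)
    (s : ℝ) (hs0 : 0 < s) (hs1 : s < 1) (hf1 : ⨆ x, f x ≠ ∞) (hg1 : ⨆ x, g x ≠ ∞)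
    (H : ∀ x y, f x ^ (1 - s) * g y ^ s ≤ h ((1 - s) * x + s * y)) :
    (∫⁻ x, f x) ^ (1 - s) * (∫⁻ x, g x) ^ s ≤ ∫⁻ x, h x := by
  have h1 : 0 < 1 - s := by linarith
  set F := ⨆ x, f x with hF
  set G := ⨆ x, g x with hG
  by_cases hF0 : F = 0
  · have : ∀ x, f x = 0 := by simpa [hF] using hF0
    simp [this, ENNReal.zero_rpow_of_pos h1]
  by_cases hG0 : G = 0
  · have : ∀ x, g x = 0 := by simpa [hG] using hG0
    simp [this, ENNReal.zero_rpow_of_pos hs0]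
  set c := F ^ (1 - s) * G ^ s with hc
  have hc0 : c ≠ 0 := mul_ne_zero (by simp [hF0, hf1]) (by simp [hG0, hg1])
  have hct : c ≠ ∞ := ENNReal.mul_ne_top (ENNReal.rpow_ne_top_of_nonneg h1.le hf1)
    (ENNReal.rpow_ne_top_of_nonneg hs0.le hg1)
  have key := pw_pl_a (fun x => F⁻¹ * f x) (fun x => G⁻¹ * g x) (fun x => c⁻¹ * h x)
    (hf.const_mul _) (hg.const_mul _) (hh.const_mul _) s hs0 hs1
    (by rw [← ENNReal.mul_iSup, ← hF, ENNReal.inv_mul_cancel hF0 hf1])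
    (by rw [← ENNReal.mul_iSup, ← hG, ENNReal.inv_mul_cancel hG0 hg1])
    (by
      intro x y
      rw [ENNReal.mul_rpow_of_nonneg _ _ h1.le, ENNReal.mul_rpow_of_nonneg _ _ hs0.le,
        ENNReal.inv_rpow, ENNReal.inv_rpow]
      calc _ = ((F ^ (1 - s))⁻¹ * (G ^ s)⁻¹) * (f x ^ (1 - s) * g y ^ s) := by ring
        _ = c⁻¹ * (f x ^ (1 - s) * g y ^ s) := by
          rw [hc, ENNReal.mul_inv (Or.inr (ENNReal.rpow_ne_top_of_nonneg hs0.le hg1))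
            (Or.inl (ENNReal.rpow_ne_top_of_nonneg h1.le hf1))]
        _ ≤ _ := by gcongr; exact H x y)
  replace key := (pw_amgm _ _ s hs0 hs1).trans key
  rw [lintegral_const_mul _ hf, lintegral_const_mul _ hg, lintegral_const_mul _ hh,
    ENNReal.mul_rpow_of_nonneg _ _ h1.le, ENNReal.mul_rpow_of_nonneg _ _ hs0.le,
        ENNReal.inv_rpow, ENNReal.inv_rpow] at key
  have e : (F ^ (1 - s))⁻¹ * (∫⁻ x, f x) ^ (1 - s) * ((G ^ s)⁻¹ * (∫⁻ x, g x) ^ s)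
      = c⁻¹ * ((∫⁻ x, f x) ^ (1 - s) * (∫⁻ x, g x) ^ s) := by
    rw [hc, ENNReal.mul_inv (Or.inr (ENNReal.rpow_ne_top_of_nonneg hs0.le hg1))
            (Or.inl (ENNReal.rpow_ne_top_of_nonneg h1.le hf1))]
    ring
  rw [e] at key
  exact (ENNReal.mul_le_mul_iff_right (ENNReal.inv_ne_zero.2 hct) (ENNReal.inv_ne_top.2 hc0)).1 key

lemma pw_pl_c (f g h : ℝ → ℝ≥0∞) (hf : Measurable f) (hg : Measurable g) (hh : Measurable h)
    (s : ℝ) (hs0 : 0 < s) (hs1 : s < 1)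
    (H : ∀ x y, f x ^ (1 - s) * g y ^ s ≤ h ((1 - s) * x + s * y)) :
    (∫⁻ x, f x) ^ (1 - s) * (∫⁻ x, g x) ^ s ≤ ∫⁻ x, h x := by
  have h1 : 0 < 1 - s := by linarith
  have hN : ∀ N : ℕ, (∫⁻ x, min (f x) N) ^ (1 - s) * (∫⁻ x, min (g x) N) ^ s ≤ ∫⁻ x, h x := by
    intro N
    apply pw_pl_b _ _ h (hf.min measurable_const) (hg.min measurable_const) hh s hs0 hs1
    · exact ((iSup_le fun x => min_le_right _ _).trans_lt (ENNReal.natCast_lt_top N)).ne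
    · exact ((iSup_le fun x => min_le_right _ _).trans_lt (ENNReal.natCast_lt_top N)).ne
    · intro x y
      refine le_trans ?_ (H x y)
      gcongr <;> exact min_le_left _ _
  have lim : ∀ f : ℝ → ℝ≥0∞, Measurable f →
      Tendsto (fun N : ℕ => ∫⁻ x, min (f x) N) atTop (nhds (∫⁻ x, f x)) := by
    intro f hf
    apply lintegral_tendsto_of_tendsto_of_monotone
    · intro n; exact (hf.min measurable_const).aemeasurable
    · refine ae_of_all _ fun x m n hmn => ?_
      exact min_le_min le_rfl (by exact_mod_cast hmn)
    · refine ae_of_all _ fun x => ?_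
      have := (tendsto_const_nhds (x := f x)).min ENNReal.tendsto_nat_nhds_top
      simpa using this
  by_cases hf0 : ∫⁻ x, f x = 0
  · simp [hf0, ENNReal.zero_rpow_of_pos h1]
  by_cases hg0 : ∫⁻ x, g x = 0
  · simp [hg0, ENNReal.zero_rpow_of_pos hs0]
  refine le_of_tendsto' (ENNReal.Tendsto.mul ((lim f hf).ennrpow_const (1 - s)) (Or.inl ?_)
    ((lim g hg).ennrpow_const s) (Or.inl ?_)) hN
  · simp [hf0, hs1.le, h1]
  · simp [hg0, hs0.le, hs0]

/-- The Prékopa-Leindler property of a measure space. -/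
def PwPL (E : Type) [AddCommGroup E] [Module ℝ E] [MeasureSpace E] : Prop :=
  ∀ (f g h : E → ℝ≥0∞), Measurable f → Measurable g → Measurable h → ∀ s : ℝ, 0 < s → s < 1 →
    (∀ x y, f x ^ (1 - s) * g y ^ s ≤ h ((1 - s) • x + s • y)) →
    (∫⁻ x, f x) ^ (1 - s) * (∫⁻ x, g x) ^ s ≤ ∫⁻ x, h x

lemma pwPL_real : PwPL ℝ := fun f g h hf hg hh s hs0 hs1 H =>
  pw_pl_c f g h hf hg hh s hs0 hs1 (by simpa using H)

lemma pwPL_pi : ∀ n : ℕ, PwPL (Fin n → ℝ)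
  | 0 => by
    intro f g h hf hg hh s hs0 hs1 H
    have e : ∀ f : (Fin 0 → ℝ) → ℝ≥0∞, ∫⁻ x, f x = f 0 := by
      intro f
      rw [lintegral_unique]
      simp only [volume_pi, Measure.pi_univ, Finset.univ_eq_empty, Finset.prod_empty, mul_one]
      exact congrArg f (Subsingleton.elim _ _)
    rw [e, e, e]
    simpa using H 0 0
  | n + 1 => by
    intro f g h hf hg hh s hs0 hs1 H
    set e := MeasurableEquiv.piFinSuccAbove (fun _ : Fin (n + 1) => ℝ) 0 with he
    have hmp : MeasurePreserving e.symm volume volume :=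
      (volume_preserving_piFinSuccAbove (fun _ : Fin (n + 1) => ℝ) 0).symm e
    have hlin : ∀ (t t' : ℝ) (y y' : Fin n → ℝ), (1 - s) • e.symm (t, y) + s • e.symm (t', y')
        = e.symm ((1 - s) • t + s • t', (1 - s) • y + s • y') := by
      intro t t' y y'
      ext i
      refine Fin.cases ?_ (fun j => ?_) i <;> simp [he, MeasurableEquiv.piFinSuccAbove]
    have hI : ∀ f : (Fin (n + 1) → ℝ) → ℝ≥0∞, Measurable f →
        ∫⁻ x, f x = ∫⁻ t : ℝ, ∫⁻ y : Fin n → ℝ, f (e.symm (t, y)) := by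
      intro f hf
      rw [← hmp.lintegral_comp hf]
      exact lintegral_prod _ (hf.comp e.symm.measurable).aemeasurable
    have hm : ∀ f : (Fin (n + 1) → ℝ) → ℝ≥0∞, Measurable f →
        Measurable fun p : ℝ × (Fin n → ℝ) => f (e.symm p) := fun f hf => hf.comp e.symm.measurable
    rw [hI f hf, hI g hg, hI h hh]
    apply pwPL_real _ _ _ (hm f hf).lintegral_prod_right' (hm g hg).lintegral_prod_right'
      (hm h hh).lintegral_prod_right' s hs0 hs1
    intro t t'
    apply pwPL_pi n _ _ _ ((hm f hf).comp measurable_prodMk_left)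
      ((hm g hg).comp measurable_prodMk_left) ((hm h hh).comp measurable_prodMk_left) s hs0 hs1
    intro y y'
    rw [Function.comp, Function.comp, Function.comp, ← hlin]
    exact H _ _

open scoped ENNReal

lemma pw_coords (n : ℕ) (e : EuclideanSpace ℝ (Fin (n + 1))) (he : ‖e‖ = 1) :
    ∃ Φ : EuclideanSpace ℝ (Fin (n + 1)) ≃L[ℝ] ℝ × (Fin n → ℝ),
      MeasurePreserving Φ volume volume ∧ ∀ x, (Φ x).1 = inner ℝ e x := by
  have ho : Orthonormal ℝ (({0} : Set (Fin (n + 1))).domRestrict (fun _ => e)) := by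
    rw [orthonormal_iff_ite]
    rintro ⟨i, hi⟩ ⟨j, hj⟩
    simp only [Set.mem_singleton_iff] at hi hj
    subst hi; subst hj
    simp [he]
  obtain ⟨b, hb⟩ := ho.exists_orthonormalBasis_extension_of_card_eq (by simp)
  have hb0 : b 0 = e := hb 0 rfl
  refine ⟨(b.repr.toContinuousLinearEquiv.trans (EuclideanSpace.equiv (Fin (n + 1)) ℝ)).trans
    (Fin.consEquivL ℝ (fun _ => ℝ)).symm, ?_, ?_⟩
  · have h1 : MeasurePreserving b.repr volume volume := b.repr.measurePreserving
    have h2 := PiLp.volume_preserving_ofLp (Fin (n + 1))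
    have h3 := volume_preserving_piFinSuccAbove (fun _ : Fin (n + 1) => ℝ) 0
    have := (h3.comp h2).comp h1
    exact this
  · intro x
    have := b.repr_apply_apply x 0
    rw [hb0] at this
    rw [← this]
    rfl

lemma pw_interval (I : Set ℝ) (ho : IsOpen I) (hc : Convex ℝ I) (hb : Bornology.IsBounded I)
    (hne : I.Nonempty) : I = Set.Ioo (sInf I) (sSup I) := by
  apply Set.Subset.antisymm
  · rw [← interior_Icc]
    apply interior_maximal _ ho
    intro x hx
    exact ⟨csInf_le hb.bddBelow hx, le_csSup hb.bddAbove hx⟩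
  · exact (show IsConnected I from ⟨hne, hc.isPreconnected⟩).Ioo_csInf_csSup_subset hb.bddBelow hb.bddAbove

lemma pw_slice_concave (n : ℕ) (K : Set (ℝ × (Fin n → ℝ))) (ho : IsOpen K) (hc : Convex ℝ K)
    (hb : Bornology.IsBounded K) (a b : ℝ) (hab : ∀ t ∈ Set.Ioo a b, ∃ y, (t, y) ∈ K) :
    (∀ t ∈ Set.Ioo a b, 0 < (volume {y | (t, y) ∈ K}).toReal) ∧
    ConcaveOn ℝ (Set.Ioo a b) (fun t => log (volume {y | (t, y) ∈ K}).toReal) := by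
  have hso : ∀ t, IsOpen {y | (t, y) ∈ K} := fun t => ho.preimage (by fun_prop)
  have hfin : ∀ t, volume {y | (t, y) ∈ K} ≠ ∞ := by
    intro t
    have : Bornology.IsBounded {y | (t, y) ∈ K} := by
      refine hb.image_snd.subset ?_
      intro y hy
      exact ⟨(t, y), hy, rfl⟩
    exact this.measure_lt_top.ne
  have hpos : ∀ t ∈ Set.Ioo a b, 0 < (volume {y | (t, y) ∈ K}).toReal := by
    intro t ht
    obtain ⟨y, hy⟩ := hab t ht
    exact ENNReal.toReal_pos ((hso t).measure_pos volume ⟨y, hy⟩).ne' (hfin t)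
  refine ⟨hpos, convex_Ioo a b, ?_⟩
  intro x hx y hy p s hp hs hps
  rcases hs.eq_or_lt with rfl | hs0
  · have : p = 1 := by linarith
    subst this; simp
  rcases hp.eq_or_lt with rfl | hp0
  · have : s = 1 := by linarith
    subst this; simp
  obtain rfl : p = 1 - s := by linarith
  have hs1 : s < 1 := by linarith
  have hxy : (1 - s) • x + s • y ∈ Set.Ioo a b := convex_Ioo a b hx hy hp hs hps
  have key := pwPL_pi n ({y | (x, y) ∈ K}.indicator 1) ({z | (y, z) ∈ K}.indicator 1)
    ({z | ((1 - s) • x + s • y, z) ∈ K}.indicator 1)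
    (measurable_one.indicator (hso _).measurableSet) (measurable_one.indicator (hso _).measurableSet)
    (measurable_one.indicator (hso _).measurableSet) s hs0 hs1 (by
      intro z w
      by_cases hz : (x, z) ∈ K
      · by_cases hw : (y, w) ∈ K
        · have : ((1 - s) • x + s • y, (1 - s) • z + s • w) ∈ K := hc hz hw hp hs hps
          rw [Set.indicator_of_mem (by exact hz), Set.indicator_of_mem (by exact hw),
            Set.indicator_of_mem (by exact this)]
          simp
        · rw [Set.indicator_of_notMem (s := {z | (y, z) ∈ K}) (by exact hw)]
          simp [ENNReal.zero_rpow_of_pos hs0]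
      · rw [Set.indicator_of_notMem (s := {y | (x, y) ∈ K}) (by exact hz)]
        simp [ENNReal.zero_rpow_of_pos hp0])
  rw [lintegral_indicator_one (hso _).measurableSet, lintegral_indicator_one (hso _).measurableSet,
    lintegral_indicator_one (hso _).measurableSet] at key
  have key2 := ENNReal.toReal_mono (hfin _) key
  rw [ENNReal.toReal_mul, ← ENNReal.toReal_rpow, ← ENNReal.toReal_rpow] at key2
  have h3 := log_le_log (mul_pos (rpow_pos_of_pos (hpos x hx) _) (rpow_pos_of_pos (hpos y hy) _)) key2
  rw [log_mul (rpow_pos_of_pos (hpos x hx) _).ne' (rpow_pos_of_pos (hpos y hy) _).ne',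
    log_rpow (hpos x hx), log_rpow (hpos y hy)] at h3
  simpa using h3

lemma pw_needle (n : ℕ) (K : Set (EuclideanSpace ℝ (Fin (n + 1)))) (ho : IsOpen K)
    (hc : Convex ℝ K) (hb : Bornology.IsBounded K) (hne : K.Nonempty)
    (e : EuclideanSpace ℝ (Fin (n + 1))) (he : ‖e‖ = 1) (D : ℝ) (hD : Metric.diam K < D)
    (v v1 : ℝ → ℝ) (hv : ∀ t, HasDerivAt v (v1 t) t) (hv1 : Continuous v1) :
    (π / D) ^ 2 * ((∫ x in K, v (inner ℝ e x) ^ 2) * (volume K).toReal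
      - (∫ x in K, v (inner ℝ e x)) ^ 2) ≤ (∫ x in K, v1 (inner ℝ e x) ^ 2) * (volume K).toReal := by
  obtain ⟨Φ, hΦ, hΦ1⟩ := pw_coords n e he
  set K' : Set (ℝ × (Fin n → ℝ)) := Φ '' K with hK'
  have hKK : Φ ⁻¹' K' = K := Set.preimage_image_eq _ Φ.injective
  have hKo : IsOpen K' := Φ.toHomeomorph.isOpenMap _ ho
  have hKc : Convex ℝ K' := hc.linear_image Φ.toLinearEquiv.toLinearMap
  have hKb : Bornology.IsBounded K' := Φ.lipschitz.isBounded_image hb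
  set I : Set ℝ := Prod.fst '' K' with hI
  have hIo : IsOpen I := isOpenMap_fst _ hKo
  have hIc : Convex ℝ I := hKc.linear_image (LinearMap.fst ℝ ℝ (Fin n → ℝ))
  have hIb : Bornology.IsBounded I := hKb.image_fst
  have hIne : I.Nonempty := (hne.image _).image _
  have hIeq := pw_interval I hIo hIc hIb hIne
  set a := sInf I
  set b := sSup I
  have hab : a < b := by
    rw [hIeq] at hIne
    exact Set.nonempty_Ioo.1 hIne
  have hdiam : b - a ≤ Metric.diam K := by
    have h1 : ∀ t ∈ I, ∀ r ∈ I, t - r ≤ Metric.diam K := by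
      rintro _ ⟨_, ⟨x, hx, rfl⟩, rfl⟩ _ ⟨_, ⟨y, hy, rfl⟩, rfl⟩
      rw [hΦ1, hΦ1, ← inner_sub_right]
      calc inner ℝ e (x - y) ≤ ‖e‖ * ‖x - y‖ := real_inner_le_norm _ _
        _ = dist x y := by rw [he, one_mul, dist_eq_norm]
        _ ≤ _ := Metric.dist_le_diam_of_mem hb hx hy
    have h2 : b ≤ a + Metric.diam K := by
      apply csSup_le hIne
      intro t ht
      have : t - Metric.diam K ≤ a := le_csInf hIne fun r hr => by linarith [h1 t ht r hr]
      linarith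
    linarith
  set A : ℝ → ℝ := fun t => (volume {y | (t, y) ∈ K'}).toReal with hA
  obtain ⟨hApos, hAconc⟩ := pw_slice_concave n K' hKo hKc hKb a b (by
    intro t ht
    rw [← hIeq] at ht
    obtain ⟨⟨t', y⟩, hy, rfl⟩ := ht
    exact ⟨y, hy⟩)
  have hA0 : ∀ t, t ∉ Set.Ioo a b → A t = 0 := by
    intro t ht
    rw [← hIeq] at ht
    have : {y | (t, y) ∈ K'} = ∅ := by
      ext y
      simp only [Set.mem_ofPred_eq, Set.mem_empty_iff_false, iff_false]
      intro hy
      exact ht ⟨_, hy, rfl⟩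
    simp only [hA, this, measure_empty, ENNReal.toReal_zero]
  -- reduction of integrals
  have hint : ∀ g : ℝ → ℝ, Continuous g → IntegrableOn (fun p : ℝ × (Fin n → ℝ) => g p.1) K' := by
    intro g hg
    have h1 : IntegrableOn (fun p : ℝ × (Fin n → ℝ) => g p.1) (closure K') :=
      (hg.comp continuous_fst).continuousOn.integrableOn_compact hKb.isCompact_closure
    exact h1.mono_set subset_closure
  have hfub : ∀ g : ℝ → ℝ, Continuous g →
      Integrable (fun t => g t * A t) ∧ ∫ x in K, g (inner ℝ e x) = ∫ t in Set.Ioo a b, g t * A t := by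
    intro g hg
    have h1 : Integrable (K'.indicator fun p : ℝ × (Fin n → ℝ) => g p.1) :=
      (hint g hg).integrable_indicator hKo.measurableSet
    have h2 : ∀ t, ∫ y : Fin n → ℝ, K'.indicator (fun p : ℝ × (Fin n → ℝ) => g p.1) (t, y)
        = g t * A t := by
      intro t
      have : ∀ y : Fin n → ℝ, K'.indicator (fun p : ℝ × (Fin n → ℝ) => g p.1) (t, y)
          = {y | (t, y) ∈ K'}.indicator (fun _ => g t) y := by
        intro y
        by_cases hy : (t, y) ∈ K'
        · rw [Set.indicator_of_mem hy, Set.indicator_of_mem (by exact hy)]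
        · rw [Set.indicator_of_notMem hy, Set.indicator_of_notMem (by exact hy)]
      simp only [this]
      rw [integral_indicator_const _ (by
        exact (hKo.preimage (by fun_prop : Continuous fun y => (t, y))).measurableSet)]
      simp [hA, Measure.real, mul_comm]
    constructor
    · have := Integrable.integral_prod_left h1
      simpa only [h2] using this
    · calc ∫ x in K, g (inner ℝ e x) = ∫ x in Φ ⁻¹' K', g (Φ x).1 := by
            rw [hKK]; simp only [hΦ1]
        _ = ∫ p in K', g p.1 :=
            hΦ.setIntegral_preimage_emb Φ.toHomeomorph.measurableEmbedding (fun p => g p.1) K'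
        _ = ∫ p, K'.indicator (fun p : ℝ × (Fin n → ℝ) => g p.1) p :=
            (integral_indicator hKo.measurableSet).symm
        _ = ∫ t, ∫ y, K'.indicator (fun p : ℝ × (Fin n → ℝ) => g p.1) (t, y) :=
            integral_prod _ h1
        _ = ∫ t, g t * A t := by simp only [h2]
        _ = _ := by
            symm
            apply setIntegral_eq_integral_of_forall_compl_eq_zero
            intro t ht
            rw [hA0 t ht, mul_zero]
  have hvc : Continuous v := continuous_iff_continuousAt.2 fun t => (hv t).continuousAt
  have hvol : (volume K).toReal = ∫ t in Set.Ioo a b, A t := by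
    have := (hfub (fun _ => 1) continuous_const).2
    simpa [Measure.real] using this
  have hAint : Integrable A := by simpa using (hfub (fun _ => 1) continuous_const).1
  have f1 := (hfub v hvc).2
  have f2 := (hfub (fun t => v t ^ 2) (by fun_prop)).2
  have f3 := (hfub (fun t => v1 t ^ 2) (by fun_prop)).2
  rw [hvol, f1, f2, f3]
  exact pw_log a b D hab (by linarith) A v v1 hApos hAconc hAint.integrableOn hv hv1

def PwGood {d : ℕ} (u w : EuclideanSpace ℝ (Fin d) → ℝ) (K : Set (EuclideanSpace ℝ (Fin d))) : Prop :=
  IsOpen K ∧ Convex ℝ K ∧ Bornology.IsBounded K ∧ (∫ x in K, u x) = 0 ∧ (∫ x in K, w x) < 0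

lemma pw_null {d : ℕ} (i j : Fin d) (hij : i ≠ j) (r s p q : ℝ) (hpq : p ≠ 0 ∨ q ≠ 0) :
    volume {x : EuclideanSpace ℝ (Fin d) | p * (x i - r) + q * (x j - s) = 0} = 0 := by
  set L : EuclideanSpace ℝ (Fin d) →ₗ[ℝ] ℝ :=
    p • (EuclideanSpace.proj i : EuclideanSpace ℝ (Fin d) →L[ℝ] ℝ).toLinearMap +
    q • (EuclideanSpace.proj j : EuclideanSpace ℝ (Fin d) →L[ℝ] ℝ).toLinearMap with hL
  have hLx : ∀ x, L x = p * x i + q * x j := by intro x; simp [hL]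
  set x0 : EuclideanSpace ℝ (Fin d) := EuclideanSpace.single i r + EuclideanSpace.single j s with hx0
  have h0i : x0 i = r := by simp [hx0, hij]
  have h0j : x0 j = s := by simp [hx0, hij.symm]
  have hset : {x : EuclideanSpace ℝ (Fin d) | p * (x i - r) + q * (x j - s) = 0}
      = (fun x => x + (-x0)) ⁻¹' (LinearMap.ker L : Set (EuclideanSpace ℝ (Fin d))) := by
    ext x
    simp only [Set.mem_ofPred_eq, Set.mem_preimage, SetLike.mem_coe, LinearMap.mem_ker, hLx,
      PiLp.add_apply, PiLp.neg_apply, h0i, h0j, sub_eq_add_neg]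
  rw [hset, measure_preimage_add_right]
  apply Measure.addHaar_submodule
  intro htop
  rw [LinearMap.ker_eq_top] at htop
  rcases hpq with h | h
  · have := hLx (EuclideanSpace.single i 1)
    rw [htop] at this
    simp [hij.symm] at this
    exact h this.symm
  · have := hLx (EuclideanSpace.single j 1)
    rw [htop] at this
    simp [hij] at this
    exact h this.symm

lemma pw_intOn {d : ℕ} (u : EuclideanSpace ℝ (Fin d) → ℝ) (hu : Continuous u)
    (K : Set (EuclideanSpace ℝ (Fin d))) (hb : Bornology.IsBounded K) : IntegrableOn u K :=
  (hu.continuousOn.integrableOn_compact hb.isCompact_closure).mono_set subset_closure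

lemma pw_split {d : ℕ} (K : Set (EuclideanSpace ℝ (Fin d))) (hK : MeasurableSet K)
    (ℓ f : EuclideanSpace ℝ (Fin d) → ℝ) (hℓ : Continuous ℓ) (h0 : volume {x | ℓ x = 0} = 0)
    (hf : IntegrableOn f K) :
    ∫ x in K, f x = (∫ x in K ∩ {x | 0 < ℓ x}, f x) + ∫ x in K ∩ {x | ℓ x < 0}, f x := by
  have hm1 : MeasurableSet {x | 0 < ℓ x} := (isOpen_lt continuous_const hℓ).measurableSet
  rw [← integral_inter_add_sdiff hm1 hf]
  congr 1
  apply setIntegral_congr_set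
  have hae : ∀ᵐ x, ¬ ℓ x = 0 := by
    rw [ae_iff]; simpa using h0
  filter_upwards [hae] with x hx
  apply propext
  change (x ∈ K ∧ ¬ (0 < ℓ x)) ↔ (x ∈ K ∧ ℓ x < 0)
  rw [not_lt]
  constructor
  · rintro ⟨h1, h2⟩; exact ⟨h1, lt_of_le_of_ne h2 hx⟩
  · rintro ⟨h1, h2⟩; exact ⟨h1, h2.le⟩

lemma pw_bisect {d : ℕ} (u w : EuclideanSpace ℝ (Fin d) → ℝ) (hu : Continuous u)
    (hw : Continuous w) (K : Set (EuclideanSpace ℝ (Fin d))) (hK : PwGood u w K)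
    (i j : Fin d) (hij : i ≠ j) (r s : ℝ) :
    ∃ K' ⊆ K, PwGood u w K' ∧ ∃ p q : ℝ, (p ≠ 0 ∨ q ≠ 0) ∧
      ∀ x ∈ K', 0 < p * (x i - r) + q * (x j - s) := by
  obtain ⟨ho, hc, hb, hu0, hw0⟩ := hK
  set ℓ : ℝ → EuclideanSpace ℝ (Fin d) → ℝ :=
    fun θ x => cos θ * (x i - r) + sin θ * (x j - s) with hℓ
  have hℓc : ∀ θ, Continuous (ℓ θ) := fun θ => by simp only [hℓ]; fun_prop
  have hℓt : ∀ x, Continuous (fun θ => ℓ θ x) := fun x => by simp only [hℓ]; fun_prop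
  have hcs : ∀ θ, cos θ ≠ 0 ∨ sin θ ≠ 0 := by
    intro θ
    by_contra! h
    have := sin_sq_add_cos_sq θ
    rw [h.1, h.2] at this
    norm_num at this
  have hnull : ∀ θ, volume {x | ℓ θ x = 0} = 0 := fun θ => pw_null i j hij r s _ _ (hcs θ)
  set g : ℝ → ℝ := fun θ => ∫ x in K ∩ {x | 0 < ℓ θ x}, u x with hg
  have hmp : ∀ θ, MeasurableSet {x | 0 < ℓ θ x} := fun θ =>
    (isOpen_lt continuous_const (hℓc θ)).measurableSet
  have hg' : ∀ θ, g θ = ∫ x in K, {x | 0 < ℓ θ x}.indicator u x := by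
    intro θ
    rw [hg, setIntegral_indicator (hmp θ)]
  have huK := pw_intOn u hu K hb
  have hgc : Continuous g := by
    rw [continuous_iff_continuousAt]
    intro θ0
    rw [show g = fun θ => ∫ x in K, {x | 0 < ℓ θ x}.indicator u x from funext hg']
    apply continuousAt_of_dominated (bound := fun x => ‖u x‖)
    · exact Eventually.of_forall fun θ => huK.aestronglyMeasurable.indicator (hmp θ)
    · exact Eventually.of_forall fun θ => ae_of_all _ fun x => norm_indicator_le_norm_self _ _
    · exact huK.norm
    · have hae : ∀ᵐ x, ¬ ℓ θ0 x = 0 := by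
        rw [ae_iff]; simpa using hnull θ0
      filter_upwards [ae_restrict_of_ae hae] with x hx
      rcases lt_or_gt_of_ne hx with h | h
      · have : ∀ᶠ θ in nhds θ0, ℓ θ x < 0 := (hℓt x).continuousAt.eventually_lt_const h
        refine (continuousAt_const (y := (0:ℝ))).congr ?_
        filter_upwards [this] with θ hθ
        rw [Set.indicator_of_notMem]
        exact not_lt.2 hθ.le
      · have : ∀ᶠ θ in nhds θ0, 0 < ℓ θ x := (hℓt x).continuousAt.eventually_const_lt h
        refine (continuousAt_const (y := u x)).congr ?_
        filter_upwards [this] with θ hθ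
        rw [Set.indicator_of_mem]
        exact hθ
  have hgpi : g π = - g 0 := by
    have h1 := pw_split K ho.measurableSet (ℓ 0) u (hℓc 0) (hnull 0) huK
    have h2 : {x | ℓ 0 x < 0} = {x | 0 < ℓ π x} := by
      ext x; simp [hℓ]
    rw [hu0, h2] at h1
    simp only [hg]
    linarith
  obtain ⟨θ, hθ⟩ : ∃ θ, g θ = 0 := by
    have hconn : IsPreconnected (Set.univ : Set ℝ) := isPreconnected_univ
    rcases le_total (g 0) 0 with h | h
    · obtain ⟨θ, -, hθ⟩ := hconn.intermediate_value (Set.mem_univ 0) (Set.mem_univ π) hgc.continuousOn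
        (show (0:ℝ) ∈ Set.Icc (g 0) (g π) from ⟨h, by linarith⟩)
      exact ⟨θ, hθ⟩
    · obtain ⟨θ, -, hθ⟩ := hconn.intermediate_value (Set.mem_univ π) (Set.mem_univ 0) hgc.continuousOn
        (show (0:ℝ) ∈ Set.Icc (g π) (g 0) from ⟨by linarith, h⟩)
      exact ⟨θ, hθ⟩
  have hsu := pw_split K ho.measurableSet (ℓ θ) u (hℓc θ) (hnull θ) huK
  have hsw := pw_split K ho.measurableSet (ℓ θ) w (hℓc θ) (hnull θ) (pw_intOn w hw K hb)
  have hu1 : ∫ x in K ∩ {x | 0 < ℓ θ x}, u x = 0 := hθ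
  have hu2 : ∫ x in K ∩ {x | ℓ θ x < 0}, u x = 0 := by linarith
  have haff : ∀ (x y : EuclideanSpace ℝ (Fin d)) (a b : ℝ), a + b = 1 →
      ℓ θ (a • x + b • y) = a * ℓ θ x + b * ℓ θ y := by
    intro x y a b hab
    have : a = 1 - b := by linarith
    subst this
    simp only [hℓ, PiLp.add_apply, PiLp.smul_apply, smul_eq_mul]
    ring
  have hcv1 : Convex ℝ {x | 0 < ℓ θ x} := by
    intro x hx y hy a b ha hb' hab
    change 0 < ℓ θ (a • x + b • y)
    rw [haff x y a b hab]
    have hx' : 0 < ℓ θ x := hx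
    have hy' : 0 < ℓ θ y := hy
    rcases ha.eq_or_lt with rfl | h
    · have : b = 1 := by linarith
      subst this; simpa using hy'
    · exact add_pos_of_pos_of_nonneg (mul_pos h hx') (mul_nonneg hb' hy'.le)
  have hcv2 : Convex ℝ {x | ℓ θ x < 0} := by
    intro x hx y hy a b ha hb' hab
    change ℓ θ (a • x + b • y) < 0
    rw [haff x y a b hab]
    have hx' : ℓ θ x < 0 := hx
    have hy' : ℓ θ y < 0 := hy
    rcases ha.eq_or_lt with rfl | h
    · have : b = 1 := by linarith
      subst this; simpa using hy'
    · nlinarith [mul_nonneg hb' (neg_pos.2 hy').le, mul_pos h (neg_pos.2 hx')]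
  by_cases hcase : ∫ x in K ∩ {x | 0 < ℓ θ x}, w x < 0
  · refine ⟨K ∩ {x | 0 < ℓ θ x}, Set.inter_subset_left,
      ⟨ho.inter (isOpen_lt continuous_const (hℓc θ)), hc.inter hcv1, hb.subset Set.inter_subset_left,
        hu1, hcase⟩, cos θ, sin θ, hcs θ, fun x hx => hx.2⟩
  · refine ⟨K ∩ {x | ℓ θ x < 0}, Set.inter_subset_left,
      ⟨ho.inter (isOpen_lt (hℓc θ) continuous_const), hc.inter hcv2, hb.subset Set.inter_subset_left,
        hu2, by linarith⟩, -cos θ, -sin θ, by simpa using hcs θ, fun x hx => ?_⟩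
    have : ℓ θ x < 0 := hx.2
    simp only [hℓ] at this
    linarith

lemma pw_thin {d : ℕ} [NeZero d] (u w : EuclideanSpace ℝ (Fin d) → ℝ) (hu : Continuous u)
    (hw : Continuous w) (Ω : Set (EuclideanSpace ℝ (Fin d))) (hΩ : PwGood u w Ω) (δ : ℝ) (hδ : 0 < δ) :
    ∃ K ⊆ Ω, PwGood u w K ∧ ∃ o e : EuclideanSpace ℝ (Fin d), ‖e‖ = 1 ∧
      ∀ x ∈ K, ‖x - (o + (inner ℝ e (x - o) : ℝ) • e)‖ < δ := by
  classical
  obtain ⟨φ, hφ⟩ := exists_surjective_nat (Fin d × Fin d × ℚ × ℚ)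
  have hstep : ∀ (n : ℕ) (K : {K // PwGood u w K}), ∃ K' : {K // PwGood u w K}, K'.1 ⊆ K.1 ∧
      ((φ n).1 ≠ (φ n).2.1 → ∃ p q : ℝ, (p ≠ 0 ∨ q ≠ 0) ∧
      ∀ x ∈ K'.1, 0 < p * (x (φ n).1 - (φ n).2.2.1) + q * (x (φ n).2.1 - (φ n).2.2.2)) := by
    intro n K
    by_cases hij : (φ n).1 = (φ n).2.1
    · exact ⟨K, subset_rfl, fun h => absurd hij h⟩
    · obtain ⟨K', h1, h2, h3⟩ := pw_bisect u w hu hw K.1 K.2 _ _ hij ((φ n).2.2.1 : ℝ) ((φ n).2.2.2 : ℝ)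
      exact ⟨⟨K', h2⟩, h1, fun _ => h3⟩
  choose st hst1 hst2 using hstep
  set S : ℕ → {K // PwGood u w K} := fun n => Nat.rec ⟨Ω, hΩ⟩ (fun n K => st n K) n with hS
  have hS1 : ∀ n, S (n + 1) = st n (S n) := fun n => rfl
  have hanti : Antitone fun n => (S n).1 := antitone_nat_of_succ_le fun n => hst1 n (S n)
  have hanti' : Antitone fun n => closure (S n).1 := fun m n h => closure_mono (hanti h)
  have hcomp : ∀ n, IsCompact (closure (S n).1) := fun n => (S n).2.2.2.1.isCompact_closure
  have hne : ∀ n, (S n).1.Nonempty := by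
    intro n
    by_contra h
    rw [Set.not_nonempty_iff_eq_empty] at h
    have := (S n).2.2.2.2.2
    rw [h] at this
    simp at this
  have hdir : Directed (fun x1 x2 => x1 ⊇ x2) fun n => closure (S n).1 := hanti'.directed_ge
  obtain ⟨o, ho⟩ : (⋂ n, closure (S n).1).Nonempty :=
    IsCompact.nonempty_iInter_of_directed_nonempty_isCompact_isClosed _ hdir
      (fun n => (hne n).closure) hcomp (fun n => isClosed_closure)
  -- collinearity
  have hcol : ∀ p ∈ ⋂ n, closure (S n).1, ∀ q ∈ ⋂ n, closure (S n).1, ∀ i j,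
      (p i - o i) * (q j - o j) - (p j - o j) * (q i - o i) = 0 := by
    intro p hp q hq i j
    by_contra hΔ
    have hij : i ≠ j := by
      rintro rfl
      apply hΔ; ring
    set Δ := (p i - o i) * (q j - o j) - (p j - o j) * (q i - o i) with hΔd
    set X : ℝ × ℝ → ℝ := fun z => ((z.1 - o i) * (q j - o j) - (z.2 - o j) * (q i - o i)) / Δ with hX
    set Y : ℝ × ℝ → ℝ := fun z => ((p i - o i) * (z.2 - o j) - (p j - o j) * (z.1 - o i)) / Δ with hY
    have hXc : Continuous X := by simp only [hX]; fun_prop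
    have hYc : Continuous Y := by simp only [hY]; fun_prop
    have hopen : IsOpen {z : ℝ × ℝ | 0 < X z ∧ 0 < Y z ∧ X z + Y z < 1} :=
      (isOpen_lt continuous_const hXc).inter ((isOpen_lt continuous_const hYc).inter
        (isOpen_lt (hXc.add hYc) continuous_const))
    have hnon : {z : ℝ × ℝ | 0 < X z ∧ 0 < Y z ∧ X z + Y z < 1}.Nonempty := by
      refine ⟨(o i + (p i - o i) / 3 + (q i - o i) / 3, o j + (p j - o j) / 3 + (q j - o j) / 3), ?_⟩
      have e1 : X (o i + (p i - o i) / 3 + (q i - o i) / 3, o j + (p j - o j) / 3 + (q j - o j) / 3)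
          = 1 / 3 := by
        simp only [hX]
        rw [div_eq_iff hΔ, hΔd]; ring
      have e2 : Y (o i + (p i - o i) / 3 + (q i - o i) / 3, o j + (p j - o j) / 3 + (q j - o j) / 3)
          = 1 / 3 := by
        simp only [hY]
        rw [div_eq_iff hΔ, hΔd]; ring
      simp only [Set.mem_ofPred_eq, e1, e2]
      norm_num
    obtain ⟨⟨r, s⟩, hrs⟩ := (Rat.denseRange_cast (𝕜 := ℝ)).prodMap
      (Rat.denseRange_cast (𝕜 := ℝ)) |>.exists_mem_open hopen hnon
    obtain ⟨n, hn⟩ := hφ (i, j, r, s)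
    have h1 := hst2 n (S n)
    rw [hn] at h1
    obtain ⟨α, β, hαβ, hpos⟩ := h1 hij
    rw [← hS1] at hpos
    have hcl : ∀ x ∈ ⋂ n, closure (S n).1, 0 ≤ α * (x i - r) + β * (x j - s) := by
      intro x hx
      have hx1 : x ∈ closure (S (n + 1)).1 := Set.mem_iInter.1 hx (n + 1)
      have hclosed : IsClosed {x : EuclideanSpace ℝ (Fin d) | 0 ≤ α * (x i - r) + β * (x j - s)} :=
        isClosed_le continuous_const (by fun_prop)
      exact closure_minimal (fun x hx => (hpos x hx).le) hclosed hx1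
    have l0 := hcl o ho
    have l1 := hcl p hp
    have l2 := hcl q hq
    have hrs' : 0 < X (r, s) ∧ 0 < Y (r, s) ∧ X (r, s) + Y (r, s) < 1 := hrs
    obtain ⟨hx0, hy0, hxy⟩ := hrs'
    have er : (r : ℝ) = o i + X (r, s) * (p i - o i) + Y (r, s) * (q i - o i) := by
      simp only [hX, hY]
      field_simp
      rw [hΔd]; ring
    have es : (s : ℝ) = o j + X (r, s) * (p j - o j) + Y (r, s) * (q j - o j) := by
      simp only [hX, hY]
      field_simp
      rw [hΔd]; ring
    generalize X (r, s) = x at *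
    generalize Y (r, s) = y at *
    have hz : (1 - x - y) * (α * (o i - r) + β * (o j - s)) + x * (α * (p i - r) + β * (p j - s))
        + y * (α * (q i - r) + β * (q j - s)) = 0 := by
      rw [er, es]; ring
    have hxy' : 0 < 1 - x - y := by linarith
    have m0 := mul_nonneg hxy'.le l0
    have m1 := mul_nonneg hx0.le l1
    have m2 := mul_nonneg hy0.le l2
    have z0 : α * (o i - r) + β * (o j - s) = 0 := by
      have : (1 - x - y) * (α * (o i - r) + β * (o j - s)) = 0 := by linarith
      exact (mul_eq_zero.1 this).resolve_left hxy'.ne'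
    have z1 : α * (p i - r) + β * (p j - s) = 0 := by
      have : x * (α * (p i - r) + β * (p j - s)) = 0 := by linarith
      exact (mul_eq_zero.1 this).resolve_left hx0.ne'
    have z2 : α * (q i - r) + β * (q j - s) = 0 := by
      have : y * (α * (q i - r) + β * (q j - s)) = 0 := by linarith
      exact (mul_eq_zero.1 this).resolve_left hy0.ne'
    have w1 : α * (p i - o i) + β * (p j - o j) = 0 := by linarith
    have w2 : α * (q i - o i) + β * (q j - o j) = 0 := by linarith
    have a0 : α * Δ = 0 := by
      rw [hΔd]; linear_combination (q j - o j) * w1 - (p j - o j) * w2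
    have b0 : β * Δ = 0 := by
      rw [hΔd]; linear_combination (p i - o i) * w2 - (q i - o i) * w1
    rcases hαβ with h | h
    · exact h ((mul_eq_zero.1 a0).resolve_right hΔ)
    · exact h ((mul_eq_zero.1 b0).resolve_right hΔ)
  -- the line
  obtain ⟨e, he, hline⟩ : ∃ e : EuclideanSpace ℝ (Fin d), ‖e‖ = 1 ∧
      ∀ q ∈ ⋂ n, closure (S n).1, ∃ c : ℝ, q - o = c • e := by
    by_cases hall : ∀ q ∈ ⋂ n, closure (S n).1, q = o
    · refine ⟨EuclideanSpace.single 0 1, by simp, fun q hq => ⟨0, ?_⟩⟩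
      rw [hall q hq]; simp
    · push Not at hall
      obtain ⟨p, hp, hpo⟩ := hall
      have hn : ‖p - o‖ ≠ 0 := by rwa [norm_ne_zero_iff, sub_ne_zero]
      refine ⟨‖p - o‖⁻¹ • (p - o), by rw [norm_smul, norm_inv, norm_norm, inv_mul_cancel₀ hn], ?_⟩
      intro q hq
      obtain ⟨i, hi⟩ : ∃ i, p i - o i ≠ 0 := by
        by_contra! h
        apply hpo
        ext i
        linarith [h i]
      refine ⟨(q i - o i) / (p i - o i) * ‖p - o‖, ?_⟩
      rw [smul_smul, mul_assoc, mul_inv_cancel₀ hn, mul_one]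
      ext j
      simp only [PiLp.sub_apply, PiLp.smul_apply, smul_eq_mul]
      have := hcol p hp q hq i j
      field_simp
      linarith
  have hU : IsOpen {x : EuclideanSpace ℝ (Fin d) | ‖x - (o + (inner ℝ e (x - o) : ℝ) • e)‖ < δ} :=
    isOpen_lt (by fun_prop) continuous_const
  obtain ⟨n, hn⟩ := exists_subset_nhds_of_isCompact hdir hcomp
    (U := {x | ‖x - (o + (inner ℝ e (x - o) : ℝ) • e)‖ < δ}) (by
      intro x hx
      apply hU.mem_nhds
      obtain ⟨c, hc⟩ := hline x hx
      have hin : inner ℝ e (x - o) = c := by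
        rw [hc, inner_smul_right, real_inner_self_eq_norm_sq, he]; norm_num
      change ‖x - (o + (inner ℝ e (x - o) : ℝ) • e)‖ < δ
      rw [hin, ← hc]
      simpa using hδ)
  refine ⟨(S n).1, hanti (Nat.zero_le n), (S n).2, o, e, he, fun x hx => hn (subset_closure hx)⟩


theorem pw_unif {d : ℕ} {F : Type*} [NormedAddCommGroup F] (g : EuclideanSpace ℝ (Fin d) → F)
    (hg : Continuous g) (R η : ℝ) (hη : 0 < η) :
    ∃ δ > 0, ∀ x y, ‖x‖ ≤ R → ‖y‖ ≤ R → ‖x - y‖ < δ → ‖g x - g y‖ < η := by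
  have hc : IsCompact (Metric.closedBall (0 : EuclideanSpace ℝ (Fin d)) R) :=
    isCompact_closedBall 0 R
  have hu := hc.uniformContinuousOn_of_continuous hg.continuousOn
  rw [Metric.uniformContinuousOn_iff] at hu
  obtain ⟨δ, hδ, h⟩ := hu η hη
  refine ⟨δ, hδ, fun x y hx hy hxy => ?_⟩
  have := h x (by simpa using hx) y (by simpa using hy) (by simpa [dist_eq_norm] using hxy)
  simpa [dist_eq_norm] using this

theorem pw_bdd {d : ℕ} {F : Type*} [NormedAddCommGroup F] (g : EuclideanSpace ℝ (Fin d) → F)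
    (hg : Continuous g) (R : ℝ) :
    ∃ M, 0 ≤ M ∧ ∀ x, ‖x‖ ≤ R → ‖g x‖ ≤ M := by
  have hc : IsCompact (Metric.closedBall (0 : EuclideanSpace ℝ (Fin d)) R) :=
    isCompact_closedBall 0 R
  obtain ⟨C, hC⟩ := hc.exists_bound_of_continuousOn hg.continuousOn
  exact ⟨max C 0, le_max_right _ _, fun x hx => (hC x (by simpa using hx)).trans (le_max_left _ _)⟩

theorem pw_alg (κ A B C U F M0 M1 η ε m : ℝ) (hκ0 : 0 ≤ κ) (hη : 0 < η) (hη1 : η ≤ 1)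
    (hmpos : 0 < m) (hηε : η * (κ * (2*M0+1) + 2*M1+1) ≤ ε)
    (hN : κ * (A * m - B^2) ≤ C * m) (hKw : F - κ * U + ε * m < 0)
    (hA : U - 2 * M0 * η * m ≤ A) (hC : C ≤ F + (2 * M1 * η + η^2) * m)
    (hB2 : B^2 ≤ (η * m)^2) : False := by
  have e1 : κ * ((U - 2 * M0 * η * m) * m - (η*m)^2) ≤ κ * (A * m - B^2) := by
    gcongr
  have e2 : C * m ≤ (F + (2 * M1 * η + η^2) * m) * m := by gcongr
  have e3 : κ * (U - 2 * M0 * η * m - η^2*m) ≤ F + (2 * M1 * η + η^2) * m := by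
    have : κ * (U - 2 * M0 * η * m - η^2*m) * m ≤ (F + (2 * M1 * η + η^2) * m) * m := by
      calc _ = κ * ((U - 2 * M0 * η * m) * m - (η*m)^2) := by ring
        _ ≤ _ := e1.trans (hN.trans e2)
    exact le_of_mul_le_mul_right this hmpos
  have e4 : η * (κ * (2*M0+1) + 2*M1+1) * m ≤ ε * m := by gcongr
  have e5 : η^2 ≤ η := by
    rw [sq]; exact mul_le_of_le_one_left hη.le hη1
  have e6 : (κ + 1) * η^2 * m ≤ (κ+1) * η * m := by gcongr
  linarith only [e3, e4, e6, hKw]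

set_option maxHeartbeats 800000 in
theorem pw_core (n : ℕ) (Ω : Set (EuclideanSpace ℝ (Fin (n+1)))) (ho : IsOpen Ω)
    (hc : Convex ℝ Ω) (hb : Bornology.IsBounded Ω)
    (u : EuclideanSpace ℝ (Fin (n+1)) → ℝ) (hu : ContDiff ℝ 1 u)
    (h0 : ∫ x in Ω, u x = 0) (D : ℝ) (hD : Metric.diam Ω < D) :
    (π / D)^2 * ∫ x in Ω, (u x)^2 ≤ ∫ x in Ω, ‖fderiv ℝ u x‖^2 := by
  by_contra hcon
  push Not at hcon
  have huc : Continuous u := hu.continuous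
  have hfc : Continuous (fderiv ℝ u) := hu.continuous_fderiv (by norm_num)
  set κ : ℝ := (π / D)^2 with hκ
  have hκ0 : 0 ≤ κ := sq_nonneg _
  have hf2 : Continuous fun x => ‖fderiv ℝ u x‖^2 := by fun_prop
  have hu2 : Continuous fun x => (u x)^2 := by fun_prop
  -- the general formula for the integral of w
  have hwint : ∀ (ε : ℝ) (K : Set (EuclideanSpace ℝ (Fin (n+1)))), Bornology.IsBounded K →
      (∫ x in K, (‖fderiv ℝ u x‖^2 - κ * (u x)^2 + ε)) =
      (∫ x in K, ‖fderiv ℝ u x‖^2) - κ * (∫ x in K, (u x)^2) + ε * (volume K).toReal := by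
    intro ε K hK
    have h1 := pw_intOn _ hf2 K hK
    have h2 := pw_intOn _ (hu2.const_mul κ) K hK
    have h12 : IntegrableOn (fun x => ‖fderiv ℝ u x‖^2 - κ * (u x)^2) K := h1.sub h2
    have h3 := pw_intOn (fun _ => ε) continuous_const K hK
    rw [integral_add h12 h3, integral_sub h1 h2, integral_const_mul, setIntegral_const]
    simp [Measure.real, mul_comm]
  obtain ⟨ε, hε, hwneg⟩ : ∃ ε > 0, (∫ x in Ω, (‖fderiv ℝ u x‖^2 - κ * (u x)^2 + ε)) < 0 := by
    set I := κ * (∫ x in Ω, (u x)^2) - ∫ x in Ω, ‖fderiv ℝ u x‖^2 with hI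
    have hIp : 0 < I := by rw [hI]; linarith
    have hm : 0 ≤ (volume Ω).toReal := ENNReal.toReal_nonneg
    refine ⟨I / (2 * ((volume Ω).toReal + 1)), by positivity, ?_⟩
    rw [hwint _ Ω hb]
    have : I / (2 * ((volume Ω).toReal + 1)) * (volume Ω).toReal < I := by
      rw [div_mul_eq_mul_div, div_lt_iff₀ (by positivity)]
      nlinarith
    linarith
  obtain ⟨R, hR⟩ := hb.exists_norm_le
  obtain ⟨M0, hM0, hM0b⟩ := pw_bdd u huc (R+1)
  obtain ⟨M1, hM1, hM1b⟩ := pw_bdd (fderiv ℝ u) hfc (R+1)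
  obtain ⟨η, hη, hη1, hηε⟩ : ∃ η > 0, η ≤ 1 ∧ η * (κ * (2*M0+1) + 2*M1+1) ≤ ε := by
    have hp : 0 < κ * (2*M0+1) + 2*M1+1 := by positivity
    refine ⟨min 1 (ε / (κ * (2*M0+1) + 2*M1+1)), by positivity, min_le_left _ _, ?_⟩
    calc _ ≤ ε / (κ * (2*M0+1) + 2*M1+1) * (κ * (2*M0+1) + 2*M1+1) := by
          gcongr; exact min_le_right _ _
      _ = ε := by field_simp
  obtain ⟨δ0, hδ0, hδ0u⟩ := pw_unif u huc (R+1) η hη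
  obtain ⟨δ1, hδ1, hδ1u⟩ := pw_unif (fderiv ℝ u) hfc (R+1) η hη
  set δ := min 1 (min δ0 δ1) with hδ
  have hδp : 0 < δ := by positivity
  have hwc : Continuous fun x => ‖fderiv ℝ u x‖^2 - κ * (u x)^2 + ε := by fun_prop
  obtain ⟨K, hKΩ, ⟨hKo, hKc, hKb, hK0, hKw⟩, o, e, he, hthin⟩ :=
    pw_thin u _ huc hwc Ω ⟨ho, hc, hb, h0, hwneg⟩ δ hδp
  have hKne : K.Nonempty := by
    by_contra hK
    rw [Set.not_nonempty_iff_eq_empty] at hK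
    rw [hK] at hKw
    simp at hKw
  have hdK : Metric.diam K < D := (Metric.diam_mono hKΩ hb).trans_lt hD
  set γ : ℝ → EuclideanSpace ℝ (Fin (n+1)) := fun t => o + (t - inner ℝ e o) • e with hγ
  have hγd : ∀ t, HasDerivAt γ e t := by
    intro t
    have h1 : HasDerivAt (fun t : ℝ => t - inner ℝ e o) 1 t :=
      (hasDerivAt_id t).sub_const _
    have h2 := (h1.smul_const e).const_add o
    rw [one_smul] at h2
    exact h2
  have hγc : Continuous γ := by rw [hγ]; fun_prop
  set v : ℝ → ℝ := fun t => u (γ t) with hv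
  set v1 : ℝ → ℝ := fun t => fderiv ℝ u (γ t) e with hv1
  have hvd : ∀ t, HasDerivAt v (v1 t) t := fun t =>
    ((hu.differentiable (by norm_num)) (γ t)).hasFDerivAt.comp_hasDerivAt t (hγd t)
  have hv1c : Continuous v1 := by
    exact (hfc.comp hγc).clm_apply continuous_const
  have hvc : Continuous v := huc.comp hγc
  have hN := pw_needle n K hKo hKc hKb hKne e he D hdK v v1 hvd hv1c
  rw [← hκ] at hN
  have hpt : ∀ x ∈ K, ‖x‖ ≤ R + 1 ∧ ‖γ (inner ℝ e x)‖ ≤ R + 1 ∧ ‖γ (inner ℝ e x) - x‖ < δ := by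
    intro x hx
    have h1 : ‖γ (inner ℝ e x) - x‖ < δ := by
      have := hthin x hx
      rw [inner_sub_right] at this
      rw [norm_sub_rev]
      exact this
    have h2 := hR x (hKΩ hx)
    refine ⟨by linarith, ?_, h1⟩
    have h3 : ‖γ (inner ℝ e x)‖ ≤ ‖γ (inner ℝ e x) - x‖ + ‖x‖ := by
      simpa using norm_add_le (γ (inner ℝ e x) - x) x
    have : δ ≤ 1 := min_le_left _ _
    linarith
  have hV : ∀ x ∈ K, |v (inner ℝ e x) - u x| ≤ η := by
    intro x hx
    obtain ⟨h1, h2, h3⟩ := hpt x hx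
    have := hδ0u _ _ h2 h1 (h3.trans_le ((min_le_right _ _).trans (min_le_left _ _)))
    rw [Real.norm_eq_abs] at this
    exact this.le
  have hV1 : ∀ x ∈ K, |v1 (inner ℝ e x)| ≤ ‖fderiv ℝ u x‖ + η := by
    intro x hx
    obtain ⟨h1, h2, h3⟩ := hpt x hx
    have h4 := hδ1u _ _ h2 h1 (h3.trans_le ((min_le_right _ _).trans (min_le_right _ _)))
    have h5 : |v1 (inner ℝ e x)| ≤ ‖fderiv ℝ u (γ (inner ℝ e x))‖ := by
      have := (fderiv ℝ u (γ (inner ℝ e x))).le_opNorm e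
      rw [he, mul_one, Real.norm_eq_abs] at this
      exact this
    have h6 : ‖fderiv ℝ u (γ (inner ℝ e x))‖ ≤
        ‖fderiv ℝ u (γ (inner ℝ e x)) - fderiv ℝ u x‖ + ‖fderiv ℝ u x‖ := by
      simpa using norm_add_le (fderiv ℝ u (γ (inner ℝ e x)) - fderiv ℝ u x) (fderiv ℝ u x)
    linarith
  have hKm : MeasurableSet K := hKo.measurableSet
  have hmpos : 0 < (volume K).toReal :=
    ENNReal.toReal_pos (hKo.measure_pos volume hKne).ne' hKb.measure_lt_top.ne
  have hcst : ∀ c : ℝ, (∫ x in K, c) = c * (volume K).toReal := by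
    intro c
    rw [setIntegral_const]; simp [Measure.real, mul_comm]
  rw [hwint _ K hKb] at hKw
  have cV : Continuous fun x => v (inner ℝ e x) := by fun_prop
  have cV1 : Continuous fun x => v1 (inner ℝ e x) := by fun_prop
  have iK : ∀ g : EuclideanSpace ℝ (Fin (n+1)) → ℝ, Continuous g → IntegrableOn g K :=
    fun g hg => pw_intOn g hg K hKb
  set m := (volume K).toReal with hm
  have hA : (∫ x in K, (u x)^2) - 2 * M0 * η * m ≤ ∫ x in K, v (inner ℝ e x)^2 := by
    rw [← hcst, ← integral_sub (iK _ hu2) (iK _ continuous_const)]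
    refine setIntegral_mono_on ((iK _ hu2).sub (iK _ continuous_const)) (iK _ (cV.pow 2)) hKm ?_
    intro x hx
    have h1 := abs_le.mp (hV x hx)
    have h2 := abs_le.mp (by simpa using hM0b x (hpt x hx).1 : |u x| ≤ M0)
    have h3 : |u x * (v (inner ℝ e x) - u x)| ≤ M0 * η := by
      rw [abs_mul]
      exact mul_le_mul (abs_le.mpr h2) (hV x hx) (abs_nonneg _) hM0
    have h4 := (abs_le.mp h3).1
    nlinarith [sq_nonneg (v (inner ℝ e x) - u x)]
  have hC : (∫ x in K, v1 (inner ℝ e x)^2) ≤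
      (∫ x in K, ‖fderiv ℝ u x‖^2) + (2 * M1 * η + η^2) * m := by
    rw [← hcst, ← integral_add (iK _ hf2) (iK _ continuous_const)]
    refine setIntegral_mono_on (iK _ (cV1.pow 2)) ((iK _ hf2).add (iK _ continuous_const)) hKm ?_
    intro x hx
    have h1 := hV1 x hx
    have h2 := hM1b x (hpt x hx).1
    have h3 : v1 (inner ℝ e x)^2 ≤ (‖fderiv ℝ u x‖ + η)^2 := by
      rw [← sq_abs (v1 _)]
      gcongr
    have h4 : ‖fderiv ℝ u x‖ * η ≤ M1 * η := by gcongr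
    nlinarith
  have hB : |∫ x in K, v (inner ℝ e x)| ≤ η * m := by
    have h1 : (∫ x in K, v (inner ℝ e x)) = ∫ x in K, (v (inner ℝ e x) - u x) := by
      rw [integral_sub (iK _ cV) (iK _ huc), hK0, sub_zero]
    rw [h1, ← Real.norm_eq_abs]
    have := norm_setIntegral_le_of_norm_le_const (μ := volume) (s := K) (C := η)
      (f := fun x => v (inner ℝ e x) - u x) hKb.measure_lt_top
      (fun x hx => by simpa using hV x hx)
    simpa [Measure.real] using this
  have hB2 : (∫ x in K, v (inner ℝ e x))^2 ≤ (η * m)^2 := by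
    rw [← sq_abs]; gcongr
  exact pw_alg κ _ _ _ _ _ M0 M1 η ε m hκ0 hη hη1 hmpos hηε hN hKw hA hC hB2

/-- The Payne–Weinberger inequality with the diameter itself. -/
theorem pw_ineq (n : ℕ) (Ω : Set (EuclideanSpace ℝ (Fin (n+1)))) (ho : IsOpen Ω)
    (hc : Convex ℝ Ω) (hb : Bornology.IsBounded Ω)
    (u : EuclideanSpace ℝ (Fin (n+1)) → ℝ) (hu : ContDiff ℝ 1 u)
    (h0 : ∫ x in Ω, u x = 0) (D : ℝ) (hD : Metric.diam Ω ≤ D) (hDp : 0 < D) :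
    (π / D)^2 * ∫ x in Ω, (u x)^2 ≤ ∫ x in Ω, ‖fderiv ℝ u x‖^2 := by
  have ht : Tendsto (fun D' : ℝ => (π / D')^2 * ∫ x in Ω, (u x)^2) (nhdsWithin D (Set.Ioi D))
      (nhds ((π / D)^2 * ∫ x in Ω, (u x)^2)) := by
    have : ContinuousAt (fun D' : ℝ => (π / D')^2 * ∫ x in Ω, (u x)^2) D := by
      have := hDp.ne'
      fun_prop (disch := assumption)
    exact this.tendsto.mono_left nhdsWithin_le_nhds
  refine le_of_tendsto ht ?_
  filter_upwards [self_mem_nhdsWithin] with D' hD'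
  exact pw_core n Ω ho hc hb u hu h0 D' (hD.trans_lt hD')


theorem pw_sq_pos {d : ℕ} (Ω : Set (EuclideanSpace ℝ (Fin d))) (ho : IsOpen Ω)
    (hb : Bornology.IsBounded Ω) (g : EuclideanSpace ℝ (Fin d) → ℝ) (hg : Continuous g)
    (h : ∃ x ∈ Ω, g x ≠ 0) : 0 < ∫ x in Ω, (g x)^2 := by
  rw [setIntegral_pos_iff_support_of_nonneg_ae (Eventually.of_forall fun x => sq_nonneg _)
    (pw_intOn _ (hg.pow 2) Ω hb)]
  obtain ⟨x, hx, hgx⟩ := h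
  refine IsOpen.measure_pos volume ?_ ⟨x, ?_, hx⟩
  · exact (hg.pow 2).isOpen_support.inter ho
  · simpa using hgx

theorem pw_sq_expand {d : ℕ} (Ω : Set (EuclideanSpace ℝ (Fin d)))
    (hb : Bornology.IsBounded Ω) (u1 u2 : EuclideanSpace ℝ (Fin d) → ℝ) (h1 : Continuous u1)
    (h2 : Continuous u2) (c1 c2 : ℝ) :
    (∫ x in Ω, (c1 * u1 x + c2 * u2 x)^2) =
      c1^2 * (∫ x in Ω, (u1 x)^2) + 2 * c1 * c2 * (∫ x in Ω, u1 x * u2 x)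
        + c2^2 * (∫ x in Ω, (u2 x)^2) := by
  have i1 : IntegrableOn (fun x => c1^2 * (u1 x)^2) Ω := pw_intOn _ (by fun_prop) Ω hb
  have i2 : IntegrableOn (fun x => 2 * c1 * c2 * (u1 x * u2 x)) Ω := pw_intOn _ (by fun_prop) Ω hb
  have i3 : IntegrableOn (fun x => c2^2 * (u2 x)^2) Ω := pw_intOn _ (by fun_prop) Ω hb
  have i12 : IntegrableOn (fun x => c1^2 * (u1 x)^2 + 2 * c1 * c2 * (u1 x * u2 x)) Ω := i1.add i2
  rw [← integral_const_mul, ← integral_const_mul, ← integral_const_mul, ← integral_add i1 i2,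
    ← integral_add i12 i3]
  congr 1
  ext x
  ring

theorem pw_quad (a b d c1 c2 N1 N2 N : ℝ) (ha : 0 < a) (hd : 0 < d) (hΔ : 0 < a * d - b^2)
    (hN1 : 0 ≤ N1) (hN2 : 0 ≤ N2) (hN : N ≤ 2 * c1^2 * N1 + 2 * c2^2 * N2)
    (hD : 0 < c1^2 * a + 2 * c1 * c2 * b + c2^2 * d) :
    N / (c1^2 * a + 2 * c1 * c2 * b + c2^2 * d) ≤ 2 * (N1 + N2) * (a + d) / (a * d - b^2) := by
  rw [div_le_div_iff₀ hD hΔ]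
  have h1 : (a * d - b^2) * (c1^2 + c2^2) ≤ (a + d) * (c1^2 * a + 2 * c1 * c2 * b + c2^2 * d) := by
    nlinarith [sq_nonneg (a * c1 + b * c2), sq_nonneg (b * c1 + d * c2)]
  have h2 : N ≤ 2 * (N1 + N2) * (c1^2 + c2^2) := by
    nlinarith [mul_nonneg hN1 (sq_nonneg c2), mul_nonneg hN2 (sq_nonneg c1)]
  calc N * (a * d - b^2) ≤ 2 * (N1 + N2) * (c1^2 + c2^2) * (a * d - b^2) := by gcongr
    _ = 2 * (N1 + N2) * ((a * d - b^2) * (c1^2 + c2^2)) := by ring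
    _ ≤ 2 * (N1 + N2) * ((a + d) * (c1^2 * a + 2 * c1 * c2 * b + c2^2 * d)) := by gcongr
    _ = _ := by ring

/-- The competitor set of the min-max principle for `k = 1` is nonempty. -/
theorem pw_exists_V (n : ℕ) (Ω : Set (EuclideanSpace ℝ (Fin (n+1)))) (ho : IsOpen Ω)
    (hne : Ω.Nonempty) : ∃ V : Submodule ℝ (EuclideanSpace ℝ (Fin (n+1)) → ℝ),
    (∀ u ∈ V, ContDiff ℝ (⊤ : ℕ∞) u) ∧
    Module.finrank ℝ (V.map (LinearMap.funLeft ℝ ℝ ((↑) : Ω → EuclideanSpace ℝ (Fin (n+1)))))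
      = 1 + 1 := by
  set R := LinearMap.funLeft ℝ ℝ ((↑) : Ω → EuclideanSpace ℝ (Fin (n+1))) with hR
  set b : Fin 2 → (EuclideanSpace ℝ (Fin (n+1)) → ℝ) := ![fun _ => 1, fun x => x 0] with hbdef
  refine ⟨Submodule.span ℝ (Set.range b), ?_, ?_⟩
  · intro u hu
    induction hu using Submodule.span_induction with
    | mem x hx =>
      obtain ⟨i, rfl⟩ := hx
      fin_cases i
      · exact contDiff_const
      · exact (EuclideanSpace.proj (𝕜 := ℝ) (0 : Fin (n+1))).contDiff
    | zero => exact contDiff_const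
    | add x y _ _ hx hy => exact hx.add hy
    | smul a x _ hx => exact contDiff_const.smul hx
  · rw [Submodule.map_span, ← Set.range_comp]
    have hli : LinearIndependent ℝ (R ∘ b) := by
      rw [Fintype.linearIndependent_iff]
      intro g hg
      rw [Fin.sum_univ_two] at hg
      have hval : ∀ x ∈ Ω, g 0 + g 1 * x 0 = 0 := by
        intro x hx
        have := congrFun hg ⟨x, hx⟩
        simpa [hR, hbdef, LinearMap.funLeft_apply] using this
      obtain ⟨p, hp⟩ := hne
      obtain ⟨ε, hε, hball⟩ := Metric.isOpen_iff.mp ho p hp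
      have hy : p + EuclideanSpace.single 0 (ε / 2) ∈ Ω := by
        apply hball
        simp only [Metric.mem_ball, dist_self_add_left, EuclideanSpace.norm_single,
          Real.norm_eq_abs, abs_of_pos (half_pos hε)]
        linarith
      have e1 := hval p hp
      have e2 := hval _ hy
      simp at e2
      have e3 : g 1 * (ε / 2) = 0 := by linarith
      have e4 : g 1 = 0 := by
        rcases mul_eq_zero.mp e3 with h | h
        · exact h
        · linarith
      have e5 : g 0 = 0 := by rw [e4] at e1; linarith
      intro i
      fin_cases i
      · exact e5
      · exact e4
    rw [finrank_span_eq_card hli]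
    simp

theorem pw_rayleigh_sup (n : ℕ) (Ω : Set (Euc (n+1))) (ho : IsOpen Ω) (hne : Ω.Nonempty)
    (hc : Convex ℝ Ω) (hb : Bornology.IsBounded Ω) (D : ℝ) (hD : Metric.diam Ω ≤ D) (hDp : 0 < D)
    (V : Submodule ℝ (Euc (n+1) → ℝ)) (hV : ∀ u ∈ V, ContDiff ℝ (⊤ : ℕ∞) u)
    (hfr : Module.finrank ℝ (V.map (LinearMap.funLeft ℝ ℝ ((↑) : Ω → Euc (n+1)))) = 1 + 1) :
    π ^ 2 / D ^ 2 ≤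
      sSup { r : ℝ | ∃ u ∈ V, (0 < ∫ x in Ω, (u x) ^ 2) ∧ r = rayleigh Ω u } := by
  set R := LinearMap.funLeft ℝ ℝ ((↑) : Ω → Euc (n+1)) with hR
  have : Module.Finite ℝ (V.map R) := Module.finite_of_finrank_pos (by omega)
  let B := Module.finBasisOfFinrankEq ℝ (V.map R) (n := 2) hfr
  obtain ⟨u1, hu1V, hu1⟩ := Submodule.mem_map.mp (B 0).2
  obtain ⟨u2, hu2V, hu2⟩ := Submodule.mem_map.mp (B 1).2
  have hspan : ∀ u ∈ V, ∃ c1 c2 : ℝ, ∀ x ∈ Ω, u x = c1 * u1 x + c2 * u2 x := by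
    intro u hu
    have h := B.sum_repr ⟨R u, Submodule.mem_map_of_mem hu⟩
    rw [Fin.sum_univ_two] at h
    refine ⟨B.repr ⟨R u, Submodule.mem_map_of_mem hu⟩ 0,
      B.repr ⟨R u, Submodule.mem_map_of_mem hu⟩ 1, fun x hx => ?_⟩
    · have h2 := congrArg Subtype.val h
      simp only [Submodule.coe_add, Submodule.coe_smul, ← hu1, ← hu2] at h2
      have h3 := congrFun h2 ⟨x, hx⟩
      simp only [Pi.add_apply, Pi.smul_apply, smul_eq_mul, hR, LinearMap.funLeft_apply] at h3
      exact h3.symm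
  have hind : ∀ c1 c2 : ℝ, (c1 ≠ 0 ∨ c2 ≠ 0) → ∃ x ∈ Ω, c1 * u1 x + c2 * u2 x ≠ 0 := by
    intro c1 c2 hcc
    by_contra hcon
    push Not at hcon
    have hz : c1 • B 0 + c2 • B 1 = 0 := by
      apply Subtype.ext
      funext x
      simp only [Submodule.coe_add, Submodule.coe_smul, ← hu1, ← hu2, hR]
      simpa [LinearMap.funLeft_apply] using hcon x x.2
    have hl := Fintype.linearIndependent_iff.mp B.linearIndependent ![c1, c2]
      (by simpa [Fin.sum_univ_two] using hz)
    have l0 := hl 0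
    have l1 := hl 1
    simp at l0 l1
    tauto
  have k1 : Continuous u1 := (hV u1 hu1V).continuous
  have k2 : Continuous u2 := (hV u2 hu2V).continuous
  have hpos : ∀ c1 c2 : ℝ, (c1 ≠ 0 ∨ c2 ≠ 0) → 0 < ∫ x in Ω, (c1 * u1 x + c2 * u2 x)^2 :=
    fun c1 c2 h => pw_sq_pos Ω ho hb _ (by fun_prop) (hind c1 c2 h)
  have hmem : ∀ c1 c2 : ℝ, (fun x => c1 * u1 x + c2 * u2 x) ∈ V := fun c1 c2 =>
    V.add_mem (V.smul_mem c1 hu1V) (V.smul_mem c2 hu2V)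
  have hC1 : ∀ u ∈ V, ContDiff ℝ 1 u := fun u hu => (hV u hu).of_le (by exact_mod_cast le_top)
  have f1 : Continuous (fderiv ℝ u1) := (hC1 _ hu1V).continuous_fderiv (by norm_num)
  have f2 : Continuous (fderiv ℝ u2) := (hC1 _ hu2V).continuous_fderiv (by norm_num)
  have hm : MeasurableSet Ω := ho.measurableSet
  -- the set is bounded above
  have hbdd : BddAbove { r : ℝ | ∃ u ∈ V, (0 < ∫ x in Ω, (u x) ^ 2) ∧ r = rayleigh Ω u } := by
    set a := ∫ x in Ω, (u1 x)^2 with ha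
    set bb := ∫ x in Ω, u1 x * u2 x with hbb
    set dd := ∫ x in Ω, (u2 x)^2 with hdd
    have ha0 : 0 < a := by simpa using hpos 1 0 (by simp)
    have hd0 : 0 < dd := by simpa using hpos 0 1 (by simp)
    have hΔ : 0 < a * dd - bb^2 := by
      have := hpos (-bb) a (Or.inr ha0.ne')
      rw [pw_sq_expand Ω hb u1 u2 k1 k2, ← ha, ← hbb, ← hdd] at this
      have h2 : 0 < a * (a * dd - bb^2) := by linarith
      exact pos_of_mul_pos_right h2 ha0.le
    refine ⟨2 * ((∫ x in Ω, ‖fderiv ℝ u1 x‖^2) + (∫ x in Ω, ‖fderiv ℝ u2 x‖^2)) * (a + dd) /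
      (a * dd - bb^2), ?_⟩
    rintro r ⟨u, huV, hup, rfl⟩
    obtain ⟨c1, c2, hcu⟩ := hspan u huV
    have e1 : (∫ x in Ω, (u x)^2) = c1^2 * a + 2 * c1 * c2 * bb + c2^2 * dd := by
      rw [ha, hbb, hdd, ← pw_sq_expand Ω hb u1 u2 k1 k2]
      exact setIntegral_congr_fun hm fun x hx => by simp only [hcu x hx]
    have e2 : (∫ x in Ω, ‖fderiv ℝ u x‖^2) ≤ 2 * c1^2 * (∫ x in Ω, ‖fderiv ℝ u1 x‖^2) +
        2 * c2^2 * (∫ x in Ω, ‖fderiv ℝ u2 x‖^2) := by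
      have i1 : IntegrableOn (fun x => 2 * c1^2 * ‖fderiv ℝ u1 x‖^2) Ω :=
        pw_intOn _ (by fun_prop) Ω hb
      have i2 : IntegrableOn (fun x => 2 * c2^2 * ‖fderiv ℝ u2 x‖^2) Ω :=
        pw_intOn _ (by fun_prop) Ω hb
      rw [← integral_const_mul, ← integral_const_mul, ← integral_add i1 i2]
      have fu : Continuous (fderiv ℝ u) := (hC1 _ huV).continuous_fderiv (by norm_num)
      refine setIntegral_mono_on (pw_intOn _ (by fun_prop) Ω hb) (i1.add i2) hm fun x hx => ?_
      have d1 : DifferentiableAt ℝ u1 x := (hC1 _ hu1V).differentiable (by norm_num) x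
      have d2 : DifferentiableAt ℝ u2 x := (hC1 _ hu2V).differentiable (by norm_num) x
      have hfd : fderiv ℝ u x = c1 • fderiv ℝ u1 x + c2 • fderiv ℝ u2 x := by
        have hev : u =ᶠ[nhds x] fun y => c1 * u1 y + c2 * u2 y := by
          filter_upwards [ho.mem_nhds hx] with y hy using hcu y hy
        rw [hev.fderiv_eq]
        exact ((d1.hasFDerivAt.const_mul c1).add (d2.hasFDerivAt.const_mul c2)).fderiv
      have hn : ‖fderiv ℝ u x‖ ≤ |c1| * ‖fderiv ℝ u1 x‖ + |c2| * ‖fderiv ℝ u2 x‖ := by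
        rw [hfd]
        refine (norm_add_le _ _).trans ?_
        rw [norm_smul, norm_smul, Real.norm_eq_abs, Real.norm_eq_abs]
      have hn2 : ‖fderiv ℝ u x‖^2 ≤ (|c1| * ‖fderiv ℝ u1 x‖ + |c2| * ‖fderiv ℝ u2 x‖)^2 := by
        gcongr
      have s1 : (|c1| * ‖fderiv ℝ u1 x‖)^2 = c1^2 * ‖fderiv ℝ u1 x‖^2 := by
        rw [mul_pow, sq_abs]
      have s2 : (|c2| * ‖fderiv ℝ u2 x‖)^2 = c2^2 * ‖fderiv ℝ u2 x‖^2 := by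
        rw [mul_pow, sq_abs]
      nlinarith only [hn2, s1, s2, sq_nonneg (|c1| * ‖fderiv ℝ u1 x‖ - |c2| * ‖fderiv ℝ u2 x‖)]
    rw [rayleigh, e1]
    rw [e1] at hup
    exact pw_quad a bb dd c1 c2 _ _ _ ha0 hd0 hΔ (integral_nonneg fun x => sq_nonneg _)
      (integral_nonneg fun x => sq_nonneg _) e2 hup
  -- a nonzero mean-zero element
  obtain ⟨c1, c2, hcc, hmean⟩ : ∃ c1 c2 : ℝ, (c1 ≠ 0 ∨ c2 ≠ 0) ∧
      (∫ x in Ω, (c1 * u1 x + c2 * u2 x)) = 0 := by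
    have hint : ∀ c1 c2 : ℝ, (∫ x in Ω, (c1 * u1 x + c2 * u2 x)) =
        c1 * (∫ x in Ω, u1 x) + c2 * ∫ x in Ω, u2 x := by
      intro c1 c2
      have i1 : IntegrableOn (fun x => c1 * u1 x) Ω := pw_intOn _ (by fun_prop) Ω hb
      have i2 : IntegrableOn (fun x => c2 * u2 x) Ω := pw_intOn _ (by fun_prop) Ω hb
      rw [integral_add i1 i2, integral_const_mul, integral_const_mul]
    by_cases h : (∫ x in Ω, u1 x) = 0
    · exact ⟨1, 0, by simp, by rw [hint, h]; ring⟩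
    · exact ⟨-(∫ x in Ω, u2 x), ∫ x in Ω, u1 x, Or.inr h, by rw [hint]; ring⟩
  have hp := hpos c1 c2 hcc
  have hpw := pw_ineq n Ω ho hc hb _ (hC1 _ (hmem c1 c2)) hmean D hD hDp
  refine le_csSup_of_le hbdd ⟨_, hmem c1 c2, hp, rfl⟩ ?_
  rw [rayleigh, le_div_iff₀ hp, ← div_pow]
  exact hpw

/-- Payne–Weinberger bound for `Ω₁` combined with monotonicity of the diameter:
`μ₁(Ω₁) ≥ π²/diam(Ω₂)²` whenever `Ω₁ ⊆ Ω₂` are nonempty bounded convex open sets. -/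
theorem payne_weinberger_nested
    (d : ℕ) (hd : 2 ≤ d) (Ω₁ Ω₂ : Set (Euc d))
    (h₁ : IsConvexDomain Ω₁) (h₂ : IsConvexDomain Ω₂) (hsub : Ω₁ ⊆ Ω₂) :
    neumannEigenvalue 1 Ω₁ ≥ Real.pi ^ 2 / Metric.diam Ω₂ ^ 2 := by
  obtain ⟨n, rfl⟩ : ∃ n, d = n + 1 := ⟨d - 1, by omega⟩
  obtain ⟨hne, ho, hb, hc⟩ := h₁
  obtain ⟨hne2, ho2, hb2, hc2⟩ := h₂
  have hDp : 0 < Metric.diam Ω₂ := by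
    obtain ⟨x, hx⟩ := hne2
    obtain ⟨ε, hε, hball⟩ := Metric.isOpen_iff.mp ho2 x hx
    have hy : x + EuclideanSpace.single 0 (ε / 2) ∈ Ω₂ := by
      apply hball
      simp only [Metric.mem_ball, dist_self_add_left, EuclideanSpace.norm_single,
        Real.norm_eq_abs, abs_of_pos (half_pos hε)]
      linarith
    have h := Metric.dist_le_diam_of_mem hb2 hy hx
    have h2 : dist (x + EuclideanSpace.single 0 (ε / 2)) x = ε / 2 := by
      simp only [dist_self_add_left, EuclideanSpace.norm_single,
        Real.norm_eq_abs, abs_of_pos (half_pos hε)]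
    linarith
  have hD : Metric.diam Ω₁ ≤ Metric.diam Ω₂ := Metric.diam_mono hsub hb2
  refine le_csInf ?_ ?_
  · obtain ⟨V, hV1, hV2⟩ := pw_exists_V n Ω₁ ho hne
    exact ⟨_, V, hV1, hV2, rfl⟩
  · rintro t ⟨V, hV1, hV2, rfl⟩
    exact pw_rayleigh_sup n Ω₁ ho hne hc hb _ hD hDp V hV1 hV2

end
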